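/- arXiv:1101.3021 — 7 statements merged into one kernel-verified Lean document; each statement's English description precedes it below -/
import Mathlib

section
/- Let n ≥ 2 be an integer and let K ⊆ ℝ^n be a centrally symmetric convex body. Then there exists a constant C_K > 0 such that for every SL_n(ℝ)-invariant Borel probability measure μ on X = SL_n(ℝ)/SL_n(ℤ) and every real r > 0: μ({⟦g⟧ ∈ X : λ_1(K, g·ℤ^n) < r}) < C_K · r^n. (The measure of the set of unimodular lattices whose first successive minimum with respect to K is less than r is at most C_K·r^n.) -/
noncomputable section

open MeasureTheory Matrix Pointwise

/-- `SL_n(ℝ)` -/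
abbrev SLR (n : ℕ) := Matrix.SpecialLinearGroup (Fin n) ℝ

instance (n : ℕ) : TopologicalSpace (SLR n) :=
  TopologicalSpace.induced (fun g => (g : Matrix (Fin n) (Fin n) ℝ)) inferInstance

/-- `SL_n(ℤ)` viewed as a subgroup of `SL_n(ℝ)`. -/
def SLZsub (n : ℕ) : Subgroup (SLR n) :=
  (Matrix.SpecialLinearGroup.map (n := Fin n) (Int.castRingHom ℝ)).range

/-- The space of unimodular lattices `X = SL_n(ℝ)/SL_n(ℤ)`. -/
abbrev XQuot (n : ℕ) := SLR n ⧸ SLZsub n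

instance (n : ℕ) : MeasurableSpace (XQuot n) := borel _

/-- The lattice `M·ℤ^n` associated to a matrix `M`. -/
def matLattice {n : ℕ} (M : Matrix (Fin n) (Fin n) ℝ) : Set (Fin n → ℝ) :=
  {x | ∃ v : Fin n → ℤ, x = M.mulVec fun i => (v i : ℝ)}

/-- The covering radius `Q(K, L) = inf{t > 0 : tK + L = ℝ^n}`. -/
def covRad (n : ℕ) (K L : Set (Fin n → ℝ)) : ℝ :=
  sInf {t : ℝ | 0 < t ∧ ∀ x : Fin n → ℝ, ∃ k ∈ K, ∃ l ∈ L, x = t • k + l}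

/-- The standard simplex `Δ_n = {x : x_i ≥ 0, ∑ x_i ≤ 1}`. -/
def simplexStd (n : ℕ) : Set (Fin n → ℝ) :=
  {x | (∀ i, 0 ≤ x i) ∧ ∑ i, x i ≤ 1}

/-- The unimodular lattice `g·ℤ^n` of `g ∈ SL_n(ℝ)`. -/
def latticeOf {n : ℕ} (g : SLR n) : Set (Fin n → ℝ) :=
  matLattice (g : Matrix (Fin n) (Fin n) ℝ)

/-- A lattice in `ℝ^n`: a subgroup of the form `B·ℤ^n` with `B` invertible. -/
def IsLattice (n : ℕ) (L : Set (Fin n → ℝ)) : Prop :=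
  ∃ B : Matrix (Fin n) (Fin n) ℝ, IsUnit B.det ∧ L = matLattice B

/-- The `i`-th successive minimum `λ_i(K, L)` of a (centrally symmetric convex
body) `K` with respect to a lattice `L`. -/
def succMin (n : ℕ) (i : ℕ) (K L : Set (Fin n → ℝ)) : ℝ :=
  sInf {t : ℝ | 0 < t ∧ i ≤ Module.finrank ℝ ↥(Submodule.span ℝ (t • K ∩ L))}

/-- The shear-and-stretch matrix contracting the `j`-th coordinate by `T ^ (n - 1)` and expanding
the others by `T`, after adding `u i` times the `j`-th coordinate to the `i`-th. -/
def shearMatrix {n : ℕ} (j : Fin n) (T : ℝ) (u : Fin n → ℝ) : Matrix (Fin n) (Fin n) ℝ :=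
  Matrix.diagonal (fun i => if i = j then (T ^ (n - 1))⁻¹ else T) *
    (1 + Matrix.vecMulVec (fun i => if i = j then 0 else u i) (Pi.single j 1))

lemma det_shearMatrix {n : ℕ} (j : Fin n) {T : ℝ} (hT : T ≠ 0) (u : Fin n → ℝ) :
    (shearMatrix j T u).det = 1 := by
  have h1 : ∏ i : Fin n, (if i = j then (T ^ (n - 1))⁻¹ else T) = 1 := by
    rw [← Finset.mul_prod_erase _ _ (Finset.mem_univ j),
      Finset.prod_congr rfl (g := fun _ => T)
        (fun i hi => if_neg (Finset.ne_of_mem_erase hi))]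
    simp [Finset.card_erase_of_mem, hT]
  rw [shearMatrix, Matrix.det_mul, Matrix.det_diagonal, h1, Matrix.vecMulVec_eq Unit,
    Matrix.det_one_add_replicateCol_mul_replicateRow]
  simp

lemma shearMatrix_mulVec {n : ℕ} (j : Fin n) (T : ℝ) (u w : Fin n → ℝ) (i : Fin n) :
    (shearMatrix j T u).mulVec w i =
      if i = j then (T ^ (n - 1))⁻¹ * w j else T * (w i + u i * w j) := by
  rw [shearMatrix, ← Matrix.mulVec_mulVec, Matrix.mulVec_diagonal, Matrix.add_mulVec,
    Matrix.one_mulVec, Matrix.vecMulVec_mulVec]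
  by_cases h : i = j
  · simp [h]
  · simp [h, mul_comm]

/-- `shearMatrix` as an element of `SL_n(ℝ)`. -/
def shear {n : ℕ} (j : Fin n) (T : ℝ) (hT : T ≠ 0) (u : Fin n → ℝ) : SLR n :=
  ⟨shearMatrix j T u, det_shearMatrix j hT u⟩

/-- The lattices containing a vector of sup norm less than `ρ` whose `j`-th coordinate exceeds
`ρ / 4` in absolute value. -/
def shortSet (n : ℕ) (j : Fin n) (ρ : ℝ) : Set (XQuot n) :=
  QuotientGroup.mk '' {g : SLR n | ∃ w ∈ latticeOf g, ρ / 4 < |w j| ∧ ∀ i, |w i| < ρ}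

lemma latticeOf_mul_subset {n : ℕ} (g γ : SLR n) (hγ : γ ∈ SLZsub n) :
    latticeOf (g * γ) ⊆ latticeOf g := by
  obtain ⟨γ, rfl⟩ := hγ
  rintro x ⟨v, rfl⟩
  refine ⟨γ.1.mulVec v, ?_⟩
  rw [Matrix.SpecialLinearGroup.coe_mul, ← Matrix.mulVec_mulVec]
  congr 1
  ext i
  simp [Matrix.mulVec, dotProduct]

lemma mk_mem_shortSet {n : ℕ} {j : Fin n} {ρ : ℝ} {g : SLR n} :
    (QuotientGroup.mk g : XQuot n) ∈ shortSet n j ρ ↔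
      ∃ v : Fin n → ℤ, ρ / 4 < |(g.1.mulVec fun i => (v i : ℝ)) j| ∧
        ∀ i, |(g.1.mulVec fun i => (v i : ℝ)) i| < ρ := by
  constructor
  · rintro ⟨h, ⟨w, hw, hw'⟩, hh⟩
    rw [QuotientGroup.eq] at hh
    have hsub := latticeOf_mul_subset g (h⁻¹ * g)⁻¹ (inv_mem hh)
    rw [show g * (h⁻¹ * g)⁻¹ = h by group] at hsub
    obtain ⟨v, rfl⟩ := hsub hw
    exact ⟨v, hw'⟩
  · rintro ⟨v, hv⟩
    exact ⟨g, ⟨_, ⟨v, rfl⟩, hv⟩, rfl⟩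

instance (n : ℕ) : BorelSpace (XQuot n) := ⟨rfl⟩

lemma continuous_coe_SLR (n : ℕ) : Continuous (fun g : SLR n => g.1) :=
  continuous_induced_dom

lemma measurableSet_shortSet (n : ℕ) (j : Fin n) (ρ : ℝ) : MeasurableSet (shortSet n j ρ) := by
  apply IsOpen.measurableSet
  apply isOpen_coinduced.2
  have : (Quotient.mk _ ⁻¹' shortSet n j ρ : Set (SLR n)) =
      ⋃ v : Fin n → ℤ, {g : SLR n | ρ / 4 < |(g.1.mulVec fun i => (v i : ℝ)) j|} ∩
        ⋂ i, {g : SLR n | |(g.1.mulVec fun i => (v i : ℝ)) i| < ρ} := by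
    ext g
    simpa using mk_mem_shortSet (g := g)
  have hc (v : Fin n → ℤ) (i : Fin n) :
      Continuous fun g : SLR n => |(g.1.mulVec fun i => (v i : ℝ)) i| :=
    (continuous_pi_iff.1 ((continuous_coe_SLR n).matrix_mulVec continuous_const) i).abs
  change IsOpen (Quotient.mk _ ⁻¹' shortSet n j ρ : Set (SLR n))
  rw [this]
  exact isOpen_iUnion fun v => (isOpen_lt continuous_const (hc v j)).inter
    (isOpen_iInter_of_finite fun i => isOpen_lt (hc v i) continuous_const)

lemma measurable_smul_XQuot {n : ℕ} (h : SLR n) : Measurable (fun x : XQuot n => h • x) := by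
  apply Continuous.measurable
  have h1 : Continuous fun g : SLR n => h * g :=
    continuous_induced_rng.2 (continuous_const.matrix_mul (continuous_coe_SLR n))
  exact continuous_coinduced_dom.2 (continuous_coinduced_rng.comp h1)

lemma card_lattice_points_le {n : ℕ} (g : SLR n) :
    ∃ D : ℝ, 0 ≤ D ∧ ∀ M : ℝ, 0 ≤ M → ∀ S : Finset (Fin n → ℤ),
      (∀ v ∈ S, ‖g.1.mulVec fun i => (v i : ℝ)‖ < M) → (S.card : ℝ) ≤ (2 * (M + D)) ^ n := by
  set L := (Matrix.toLin' g.1).toContinuousLinearMap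
  refine ⟨‖L‖, norm_nonneg _, fun M hM S hS => ?_⟩
  set cube : (Fin n → ℤ) → Set (Fin n → ℝ) :=
    fun v => Set.pi Set.univ fun i => Set.Ico (v i : ℝ) (v i + 1)
  have hvol : volume (⋃ v ∈ S, cube v) = S.card := by
    rw [measure_biUnion_finset]
    · simp [cube, Real.volume_pi_Ico]
    · intro v _ w _ hvw
      refine Set.disjoint_left.2 fun x hx hx' => hvw ?_
      ext i
      have h1 := Int.floor_eq_iff.2 (hx i trivial)
      have h2 := Int.floor_eq_iff.2 (hx' i trivial)
      omega
    · exact fun v _ => MeasurableSet.univ_pi fun i => measurableSet_Ico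
  have hsub : (⋃ v ∈ S, cube v) ⊆ (Matrix.toLin' g.1) ⁻¹' Metric.ball 0 (M + ‖L‖) := by
    refine Set.iUnion₂_subset fun v hv x hx => ?_
    have hx1 : ‖x - fun i => (v i : ℝ)‖ ≤ 1 := by
      refine (pi_norm_le_iff_of_nonneg zero_le_one).2 fun i => ?_
      have := hx i trivial
      rw [Pi.sub_apply, Real.norm_eq_abs, abs_le]
      constructor <;> linarith [this.1, this.2]
    have h2 : ‖L (x - fun i => (v i : ℝ))‖ ≤ ‖L‖ :=
      (L.le_opNorm _).trans (mul_le_of_le_one_right (norm_nonneg _) hx1)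
    have h3 : L x = L (x - fun i => (v i : ℝ)) + g.1.mulVec fun i => (v i : ℝ) := by
      rw [map_sub]; simp [L]
    have h4 : ‖L x‖ < M + ‖L‖ := by
      rw [h3]
      linarith [norm_add_le (L (x - fun i => (v i : ℝ))) (g.1.mulVec fun i => (v i : ℝ)), hS v hv]
    exact mem_ball_zero_iff.2 h4
  have hle := measure_mono (μ := volume) hsub
  have hdet : LinearMap.det (Matrix.toLin' g.1) = 1 := by
    rw [LinearMap.det_toLin']; exact g.2
  rw [hvol, Measure.addHaar_preimage_linearMap _ (by rw [hdet]; exact one_ne_zero), hdet] at hle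
  have hD : 0 ≤ M + ‖L‖ := by positivity
  rcases hD.eq_or_lt with h0 | h0
  · have : S = ∅ := by
      refine Finset.eq_empty_of_forall_notMem fun v hv => ?_
      linarith [hS v hv, norm_nonneg (g.1.mulVec fun i => (v i : ℝ)), norm_nonneg L]
    rw [this, ← h0]
    simp
  · rw [Real.volume_pi_ball _ h0] at hle
    simp only [inv_one, abs_one, ENNReal.ofReal_one, one_mul, Fintype.card_fin] at hle
    rw [← ENNReal.ofReal_natCast] at hle
    exact (ENNReal.ofReal_le_ofReal_iff (by positivity)).1 hle

lemma card_fin_mem_interval_le {N : ℕ} (hN : 0 < N) {a b ε : ℝ} (hb : 0 < |b|)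
    (h : 2 * ε * N ≤ 8 * |b|) (S : Finset (Fin N))
    (hS : ∀ k ∈ S, |a + (k : ℝ) / N * b| < ε) : S.card ≤ 9 := by
  rcases S.eq_empty_or_nonempty with rfl | hne
  · simp
  set m := S.min' hne
  have hm := S.min'_mem hne
  have hsub : S.map Fin.valEmbedding ⊆ Finset.Ico (m : ℕ) (m + 9) := by
    intro k hk
    obtain ⟨k, hkS, rfl⟩ := Finset.mem_map.1 hk
    have hmk : m ≤ k := S.min'_le k hkS
    refine Finset.mem_Ico.2 ⟨hmk, ?_⟩
    have h1 := hS k hkS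
    have h2 := hS m hm
    have hmk' : ((m : ℕ) : ℝ) ≤ (k : ℕ) := by exact_mod_cast hmk
    have hN' : (0 : ℝ) < N := by exact_mod_cast hN
    have h3 : ((k : ℕ) - (m : ℕ) : ℝ) / N * |b| < 2 * ε := by
      rw [← abs_of_nonneg (show (0 : ℝ) ≤ ((k : ℕ) - (m : ℕ) : ℝ) / N by
        apply div_nonneg (by linarith) hN'.le), ← abs_mul]
      rw [show ((k : ℕ) - (m : ℕ) : ℝ) / N * b =
        (a + ((k : ℕ) : ℝ) / N * b) - (a + ((m : ℕ) : ℝ) / N * b) by ring]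
      exact (abs_sub _ _).trans_lt (by linarith)
    rw [div_mul_eq_mul_div, div_lt_iff₀ hN'] at h3
    have h4 : ((k : ℕ) - (m : ℕ) : ℝ) < 8 := lt_of_mul_lt_mul_right (h3.trans_le h) hb.le
    have h5 : ((k : ℕ) : ℝ) < ((m : ℕ) + 9 : ℕ) := by push_cast; linarith
    exact_mod_cast h5
  simpa using Finset.card_le_card hsub

lemma card_shears_le {n : ℕ} (j : Fin n) {N : ℕ} (hN : 0 < N) {ε : ℝ} (w : Fin n → ℝ)
    (hw : 0 < |w j|) (h : 2 * ε * N ≤ 8 * |w j|) (S : Finset (Fin n → Fin N))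
    (hS : ∀ s ∈ S, ∀ i ≠ j, |w i + (s i : ℝ) / N * w j| < ε) :
    S.card ≤ N * 9 ^ (n - 1) := by
  classical
  set P : Fin n → Finset (Fin N) := fun i =>
    if i = j then Finset.univ else Finset.univ.filter fun k => |w i + (k : ℝ) / N * w j| < ε
  have hsub : S ⊆ Fintype.piFinset P := by
    intro s hs
    refine Fintype.mem_piFinset.2 fun i => ?_
    by_cases hi : i = j
    · simp [P, hi]
    · simpa [P, hi] using hS s hs i hi
  refine (Finset.card_le_card hsub).trans ?_
  rw [Fintype.card_piFinset, ← Finset.mul_prod_erase _ _ (Finset.mem_univ j)]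
  refine Nat.mul_le_mul (by simp [P]) ?_
  refine (Finset.prod_le_pow_card _ _ 9 fun i hi => ?_).trans ?_
  · simp only [P, if_neg (Finset.ne_of_mem_erase hi)]
    exact card_fin_mem_interval_le hN hw h _ fun k hk => (Finset.mem_filter.1 hk).2
  · simp [Finset.card_erase_of_mem]

open Classical in
lemma eventually_card_shear_mem_le {n : ℕ} (hn : 2 ≤ n) (j : Fin n) {ρ : ℝ} (hρ : 0 < ρ)
    (g : SLR n) :
    ∀ᶠ t : ℕ in Filter.atTop,
      ((Finset.univ.filter fun s : Fin n → Fin ((t + 1) ^ n) =>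
        (QuotientGroup.mk (shear j ((t : ℝ) + 1) (Nat.cast_add_one_ne_zero t)
          (fun i => (s i : ℝ) / ((t + 1) ^ n : ℕ)) * g) : XQuot n) ∈ shortSet n j ρ).card : ℝ)
        ≤ (72 * ρ) ^ n * (((t + 1) ^ n : ℕ) : ℝ) ^ n := by
  obtain ⟨D, hD, hcard⟩ := card_lattice_points_le g
  obtain ⟨m, rfl⟩ : ∃ m, n = m + 1 := ⟨n - 1, by omega⟩
  filter_upwards [Filter.eventually_ge_atTop ⌈D / (2 * ρ)⌉₊] with t ht
  set T : ℝ := (t : ℝ) + 1 with hT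
  have hT1 : 1 ≤ T := by linarith [Nat.cast_nonneg (α := ℝ) t]
  have hT0 : 0 < T := by linarith
  have hTm : T ≤ T ^ m := le_self_pow₀ hT1 (by omega)
  have hlarge : D ≤ 2 * ρ * T ^ m := by
    have h1 : D / (2 * ρ) ≤ t := (Nat.le_ceil _).trans (by exact_mod_cast ht)
    rw [div_le_iff₀ (by positivity)] at h1
    nlinarith
  set N : ℕ := (t + 1) ^ (m + 1) with hN
  have hNT : (N : ℝ) = T ^ (m + 1) := by rw [hN, hT]; push_cast; rfl
  have hN0 : 0 < N := by positivity
  set F := Finset.univ.filter fun s : Fin (m + 1) → Fin N =>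
    (QuotientGroup.mk (shear j T (Nat.cast_add_one_ne_zero t) (fun i => (s i : ℝ) / N) * g) :
      XQuot (m + 1)) ∈ shortSet (m + 1) j ρ with hF
  set W : (Fin (m + 1) → ℤ) → Fin (m + 1) → ℝ := fun v => g.1.mulVec fun i => (v i : ℝ) with hW
  have key : ∀ s ∈ F, ∃ v, ρ / 4 * T ^ m < |W v j| ∧ ‖W v‖ < 2 * ρ * T ^ m ∧
      ∀ i ≠ j, |W v i + (s i : ℝ) / N * W v j| < ρ / T := by
    intro s hs
    obtain ⟨v, h1, h2⟩ := mk_mem_shortSet.1 (Finset.mem_filter.1 hs).2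
    have hmul (i : Fin (m + 1)) :
        ((shear j T (Nat.cast_add_one_ne_zero t) (fun i => (s i : ℝ) / N) * g).1.mulVec
          fun i => (v i : ℝ)) i = if i = j then (T ^ m)⁻¹ * W v j else
            T * (W v i + (s i : ℝ) / N * W v j) := by
      rw [Matrix.SpecialLinearGroup.coe_mul, ← Matrix.mulVec_mulVec]
      exact shearMatrix_mulVec j T _ _ i
    have hTp : 0 < T ^ m := by positivity
    have hj := h2 j
    rw [hmul, if_pos rfl, abs_mul, abs_inv, abs_of_pos hTp, inv_mul_eq_div] at h1 hj
    rw [lt_div_iff₀ hTp] at h1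
    rw [div_lt_iff₀ hTp] at hj
    have hi (i : Fin (m + 1)) (hi : i ≠ j) : |W v i + (s i : ℝ) / N * W v j| < ρ / T := by
      have := h2 i
      rwa [hmul, if_neg hi, abs_mul, abs_of_pos hT0, mul_comm, ← lt_div_iff₀ hT0] at this
    refine ⟨v, h1, ?_, hi⟩
    refine (pi_norm_lt_iff (by positivity)).2 fun i => ?_
    rw [Real.norm_eq_abs]
    by_cases hij : i = j
    · rw [hij]; nlinarith
    have h3 : |(s i : ℝ) / N * W v j| ≤ |W v j| := by
      rw [abs_mul]
      refine mul_le_of_le_one_left (abs_nonneg _) ?_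
      rw [abs_of_nonneg (by positivity), div_le_one (by exact_mod_cast hN0)]
      exact_mod_cast (s i).2.le
    have h4 : ρ / T ≤ ρ * T ^ m := by
      rw [div_le_iff₀ hT0]
      have : 1 ≤ T ^ m * T := by nlinarith
      nlinarith
    have h5 := abs_sub (W v i + (s i : ℝ) / N * W v j) ((s i : ℝ) / N * W v j)
    rw [add_sub_cancel_right] at h5
    linarith [hi i hij]
  choose! V hV1 hV2 hV3 using key
  have hS : ((F.image V).card : ℝ) ≤ (8 * ρ * T ^ m) ^ (m + 1) := by
    refine (hcard (2 * ρ * T ^ m) (by positivity) (F.image V) fun v hv => ?_).trans ?_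
    · obtain ⟨s, hs, rfl⟩ := Finset.mem_image.1 hv
      exact hV2 s hs
    · exact pow_le_pow_left₀ (by positivity) (by linarith) _
  have hfib : ∀ v ∈ F.image V, (F.filter fun s => V s = v).card ≤ N * 9 ^ m := by
    intro v hv
    obtain ⟨s, hs, rfl⟩ := Finset.mem_image.1 hv
    have hpos : 0 < ρ / 4 * T ^ m := by positivity
    refine card_shears_le j hN0 (ε := ρ / T) (W (V s)) (hpos.trans (hV1 s hs)) ?_ _ ?_
    · have : 2 * (ρ / T) * N = 8 * (ρ / 4 * T ^ m) := by
        rw [hNT, pow_succ]; field_simp; norm_num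
      rw [this]
      linarith [hV1 s hs]
    · intro s' hs' i hi
      obtain ⟨h1, h2⟩ := Finset.mem_filter.1 hs'
      rw [← h2]
      exact hV3 s' h1 i hi
  have hcount : F.card ≤ (N * 9 ^ m) * (F.image V).card :=
    Finset.card_le_mul_card_image F _ hfib
  calc (F.card : ℝ) ≤ (N * 9 ^ m) * (F.image V).card := by exact_mod_cast hcount
    _ ≤ (N * 9 ^ (m + 1)) * (8 * ρ * T ^ m) ^ (m + 1) := by
      gcongr
      · norm_num
      · omega
    _ = (72 * ρ) ^ (m + 1) * (N : ℝ) ^ (m + 1) := by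
      rw [show (72 : ℝ) * ρ = 9 * (8 * ρ) by ring, hNT, mul_pow (8 * ρ), mul_pow 9]
      rw [pow_succ T m, mul_pow (T ^ m)]
      ring

lemma measure_shortSet_le {n : ℕ} (hn : 2 ≤ n) (j : Fin n) {ρ : ℝ} (hρ : 0 < ρ)
    (μ : Measure (XQuot n)) [IsProbabilityMeasure μ]
    (hμ : ∀ g : SLR n, Measure.map (fun x => g • x) μ = μ) :
    μ (shortSet n j ρ) ≤ ENNReal.ofReal ((72 * ρ) ^ n) := by
  classical
  set A := shortSet n j ρ with hA
  have hAm : MeasurableSet A := measurableSet_shortSet n j ρ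
  let h (t : ℕ) (s : Fin n → Fin ((t + 1) ^ n)) : SLR n :=
    shear j ((t : ℝ) + 1) (Nat.cast_add_one_ne_zero t) (fun i => (s i : ℝ) / ((t + 1) ^ n : ℕ))
  let f (t : ℕ) (x : XQuot n) : ENNReal :=
    ((((t + 1) ^ n : ℕ) : ENNReal) ^ n)⁻¹ * ∑ s, A.indicator 1 (h t s • x)
  have hpos (t : ℕ) : (((t + 1) ^ n : ℕ) : ENNReal) ^ n ≠ 0 := by positivity
  have hfin (t : ℕ) : (((t + 1) ^ n : ℕ) : ENNReal) ^ n ≠ ⊤ := by finiteness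
  have hind : Measurable (A.indicator (1 : XQuot n → ENNReal)) :=
    measurable_one.indicator hAm
  have hindh (t : ℕ) (s : Fin n → Fin ((t + 1) ^ n)) :
      Measurable fun x => A.indicator (1 : XQuot n → ENNReal) (h t s • x) :=
    hind.comp (measurable_smul_XQuot (h t s))
  have hfm (t : ℕ) : Measurable (f t) :=
    (Finset.measurable_sum _ fun s _ => hindh t s).const_mul _
  have hf1 (t : ℕ) (x : XQuot n) : f t x ≤ 1 := by
    have : ∑ s, A.indicator (1 : XQuot n → ENNReal) (h t s • x) ≤
        (((t + 1) ^ n : ℕ) : ENNReal) ^ n := by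
      refine (Finset.sum_le_card_nsmul _ _ 1 fun s _ =>
        Set.indicator_le_self' (fun _ _ => zero_le_one) _).trans ?_
      simp
    exact (mul_le_mul_right this _).trans (ENNReal.inv_mul_cancel (hpos t) (hfin t)).le
  have hint (t : ℕ) : ∫⁻ x, f t x ∂μ = μ A := by
    have h1 (s : Fin n → Fin ((t + 1) ^ n)) :
        ∫⁻ x, A.indicator (1 : XQuot n → ENNReal) (h t s • x) ∂μ = μ A := by
      rw [← lintegral_map hind (measurable_smul_XQuot (h t s)), hμ, lintegral_indicator_one hAm]
    change ∫⁻ x, _ * ∑ s, A.indicator (1 : XQuot n → ENNReal) (h t s • x) ∂μ = μ A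
    rw [lintegral_const_mul _ (Finset.measurable_sum _ fun s _ =>
        hindh t s),
      lintegral_finsetSum _ fun s _ => hindh t s]
    simp only [h1, Finset.sum_const, Finset.card_univ, Fintype.card_pi, Fintype.card_fin,
      Finset.prod_const, nsmul_eq_mul]
    rw [← mul_assoc, Nat.cast_pow ((t + 1) ^ n) n, ENNReal.inv_mul_cancel (hpos t) (hfin t), one_mul]
  have hlim (x : XQuot n) :
      Filter.limsup (fun t => f t x) Filter.atTop ≤ ENNReal.ofReal ((72 * ρ) ^ n) := by
    obtain ⟨g, rfl⟩ := QuotientGroup.mk_surjective x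
    refine Filter.limsup_le_of_le (by isBoundedDefault) ?_
    filter_upwards [eventually_card_shear_mem_le hn j hρ g] with t ht
    have hsum : ∑ s, A.indicator (1 : XQuot n → ENNReal)
        (h t s • (QuotientGroup.mk g : XQuot n)) = ((Finset.univ.filter fun s =>
          (QuotientGroup.mk (h t s * g) : XQuot n) ∈ A).card : ENNReal) := by
      rw [← Finset.sum_boole]
      exact Finset.sum_congr rfl fun s _ => rfl
    change _ * _ ≤ _
    rw [hsum, ENNReal.inv_mul_le_iff (hpos t) (hfin t), mul_comm, ← ENNReal.ofReal_natCast,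
      ← ENNReal.ofReal_natCast, ← ENNReal.ofReal_pow (by positivity),
      ← ENNReal.ofReal_mul (by positivity)]
    exact ENNReal.ofReal_le_ofReal ht
  have hfatou := limsup_lintegral_le (μ := μ) (f := f) 1 hfm
    (fun t => Filter.Eventually.of_forall (hf1 t)) (by simp)
  simp only [hint, Filter.limsup_const] at hfatou
  refine hfatou.trans ((lintegral_mono hlim).trans ?_)
  simp

lemma exists_mk_mem_shortSet {n : ℕ} {g : SLR n} {ρ : ℝ} {x : Fin n → ℝ}
    (hx : x ∈ latticeOf g) (hx0 : x ≠ 0) (hxρ : ‖x‖ < ρ) :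
    ∃ j, (QuotientGroup.mk g : XQuot n) ∈ shortSet n j ρ := by
  obtain ⟨v, rfl⟩ := hx
  set w := (g : Matrix (Fin n) (Fin n) ℝ).mulVec fun i => (v i : ℝ) with hw
  have hpos : 0 < ‖w‖ := norm_pos_iff.2 hx0
  have : Nonempty (Fin n) := by
    by_contra hne
    rw [not_nonempty_iff] at hne
    exact hx0 (Subsingleton.elim _ _)
  obtain ⟨j, hj⟩ : ∃ j, ‖w j‖ = ‖w‖ := by
    obtain ⟨j, hj⟩ := Finite.exists_max fun i => ‖w i‖
    exact ⟨j, le_antisymm (norm_le_pi_norm w j)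
      ((pi_norm_le_iff_of_nonneg (norm_nonneg _)).2 hj)⟩
  refine ⟨j, mk_mem_shortSet.2 ?_⟩
  obtain ⟨k, hk1, hk2⟩ : ∃ k : ℕ, ρ / 4 < k * ‖w‖ ∧ k * ‖w‖ < ρ := by
    rcases lt_or_ge (ρ / 4) ‖w‖ with h | h
    · exact ⟨1, by simpa using h, by simpa using hxρ⟩
    · refine ⟨⌊ρ / 4 / ‖w‖⌋₊ + 1, ?_, ?_⟩
      · rw [← div_lt_iff₀ hpos]
        exact_mod_cast Nat.lt_floor_add_one _
      · have := Nat.floor_le (show 0 ≤ ρ / 4 / ‖w‖ by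
          apply div_nonneg _ hpos.le
          linarith)
        rw [le_div_iff₀ hpos] at this
        push_cast
        linarith
  have hmul : (g.1.mulVec fun i => (((k : ℤ) • v) i : ℝ)) = (k : ℝ) • w := by
    rw [hw, ← Matrix.mulVec_smul]
    congr 1
    ext i
    simp
  refine ⟨(k : ℤ) • v, ?_, fun i => ?_⟩
  · rw [hmul, Pi.smul_apply, smul_eq_mul, abs_mul, Nat.abs_cast, ← Real.norm_eq_abs, hj]
    exact hk1
  · rw [hmul, Pi.smul_apply, smul_eq_mul, abs_mul, Nat.abs_cast, ← Real.norm_eq_abs]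
    exact (mul_le_mul_of_nonneg_left (norm_le_pi_norm w i) k.cast_nonneg).trans_lt hk2

lemma zero_mem_interior_of_symm {n : ℕ} {K : Set (Fin n → ℝ)} (hKconvex : Convex ℝ K)
    (hKint : (interior K).Nonempty) (hKsymm : K = -K) : 0 ∈ interior K := by
  obtain ⟨y, hy⟩ := hKint
  have hy' : -y ∈ interior K := by
    have hy2 := (Homeomorph.neg (Fin n → ℝ)).preimage_interior K
    rw [show (Homeomorph.neg (Fin n → ℝ)) ⁻¹' K = K from hKsymm.symm] at hy2
    rw [← hy2] at hy
    exact hy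
  have := hKconvex.interior hy hy' (show (0 : ℝ) ≤ 1 / 2 by norm_num)
    (show (0 : ℝ) ≤ 1 / 2 by norm_num) (by norm_num)
  simpa using this

lemma exists_short_of_succMin_lt {n : ℕ} [NeZero n] {K : Set (Fin n → ℝ)} (hK0 : 0 ∈ interior K)
    {R : ℝ} (hR : 0 < R) (hKR : ∀ x ∈ K, ‖x‖ ≤ R) {g : SLR n} {r : ℝ}
    (hr : succMin n 1 K (latticeOf g) < r) :
    ∃ x ∈ latticeOf g, x ≠ 0 ∧ ‖x‖ < r * R := by
  have hne : {t : ℝ | 0 < t ∧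
      1 ≤ Module.finrank ℝ ↥(Submodule.span ℝ (t • K ∩ latticeOf g))}.Nonempty := by
    set w := g.1.mulVec fun i => ((Pi.single 0 1 : Fin n → ℤ) i : ℝ) with hw
    have hw0 : w ≠ 0 := by
      intro h0
      have hinj := Matrix.mulVec_injective_iff_isUnit.2
        ((Matrix.isUnit_iff_isUnit_det g.1).2 (by rw [g.2]; exact isUnit_one))
      have := congrFun (hinj (h0.trans (Matrix.mulVec_zero g.1).symm)) 0
      simp at this
    obtain ⟨t, ht, hmem⟩ := ((absorbent_nhds_zero
      (mem_interior_iff_mem_nhds.1 hK0) : Absorbent ℝ K) w).exists_pos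
    have hwt : w ∈ t • K := hmem t (by simp [abs_of_pos ht]) rfl
    refine ⟨t, ht, Submodule.one_le_finrank_iff.2 fun hbot => hw0 ?_⟩
    exact (Submodule.mem_bot ℝ).1 (hbot ▸ Submodule.subset_span ⟨hwt, _, rfl⟩)
  obtain ⟨t, ⟨ht, hfr⟩, htr⟩ := exists_lt_of_csInf_lt hne hr
  by_contra! hcon
  refine Submodule.one_le_finrank_iff.1 hfr (Submodule.span_eq_bot.2 fun x hx => ?_)
  by_contra hx0
  obtain ⟨⟨y, hy, rfl⟩, hxl⟩ := hx
  have h1 := hcon _ hxl hx0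
  have h2 : ‖t • y‖ ≤ t * R := by
    rw [norm_smul, Real.norm_of_nonneg ht.le]
    exact mul_le_mul_of_nonneg_left (hKR y hy) ht.le
  have h3 := mul_lt_mul_of_pos_right htr hR
  exact absurd (h1.trans h2) (not_le.2 h3)

/-- The Haar measure of the set of unimodular lattices whose first successive
minimum with respect to a centrally symmetric convex body `K` is `< r` is
at most `C_K·r^n`. -/
theorem first_minimum_measure_bound (n : ℕ) (hn : 2 ≤ n) (K : Set (Fin n → ℝ))
    (hKcompact : IsCompact K) (hKconvex : Convex ℝ K)
    (hKint : (interior K).Nonempty) (hKsymm : K = -K) :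
    ∃ C : ℝ, 0 < C ∧
      ∀ (μ : Measure (XQuot n)), IsProbabilityMeasure μ →
        (∀ g : SLR n, Measure.map (fun x => g • x) μ = μ) →
        ∀ r : ℝ, 0 < r →
          μ (QuotientGroup.mk '' {g : SLR n | succMin n 1 K (latticeOf g) < r})
            < ENNReal.ofReal (C * r ^ n) := by
  obtain ⟨R, hR, hKR⟩ := hKcompact.isBounded.exists_pos_norm_le
  have : NeZero n := ⟨by omega⟩
  have hK0 := zero_mem_interior_of_symm hKconvex hKint hKsymm
  refine ⟨n * (72 * R) ^ n + 1, by positivity, fun μ hprob hμ r hr => ?_⟩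
  have hsub : QuotientGroup.mk '' {g : SLR n | succMin n 1 K (latticeOf g) < r} ⊆
      ⋃ j ∈ (Finset.univ : Finset (Fin n)), shortSet n j (r * R) := by
    rintro _ ⟨g, hg, rfl⟩
    obtain ⟨x, hx, hx0, hxr⟩ := exists_short_of_succMin_lt hK0 hR hKR hg
    obtain ⟨j, hj⟩ := exists_mk_mem_shortSet hx hx0 hxr
    exact Set.mem_biUnion (Finset.mem_univ j) hj
  calc μ (QuotientGroup.mk '' {g : SLR n | succMin n 1 K (latticeOf g) < r})
      ≤ ∑ j : Fin n, μ (shortSet n j (r * R)) :=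
        (measure_mono hsub).trans (measure_biUnion_finset_le _ _)
    _ ≤ ∑ _j : Fin n, ENNReal.ofReal ((72 * (r * R)) ^ n) :=
        Finset.sum_le_sum fun j _ => measure_shortSet_le hn j (by positivity) μ hμ
    _ = ENNReal.ofReal (n * (72 * (r * R)) ^ n) := by
        rw [Finset.sum_const, Finset.card_univ, Fintype.card_fin, nsmul_eq_mul,
          ENNReal.ofReal_mul (by positivity), ENNReal.ofReal_natCast]
    _ < ENNReal.ofReal ((n * (72 * R) ^ n + 1) * r ^ n) := by
        refine (ENNReal.ofReal_lt_ofReal_iff (by positivity)).2 ?_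
        have : 0 < r ^ n := by positivity
        rw [show 72 * (r * R) = 72 * R * r by ring, mul_pow]
        nlinarith
end
end

section
/- (Kannan; Aliev–Gruber.) Let d ≥ 3 be an integer and let a ∈ ℤ^d satisfy gcd(a_1, …, a_d) = 1, a_i ≥ 2 for all i, and a_i ≤ a_d for i = 1, …, d−1. Let L be the lattice in ℝ^{d−1} given by L = (a_1⋯a_d)^{−1/(d−1)} · {(a_1 b_1, a_2 b_2, …, a_{d−1} b_{d−1}) : b ∈ M_a}. Then (F(a) + Σ_{i=1}^d a_i) / (a_1⋯a_d)^{1/(d−1)} = Q(Δ_{d−1}, L). Equivalently, F(a) + Σ_{i=1}^d a_i = Q(Δ_{d−1}, {(a_1 b_1, …, a_{d−1} b_{d−1}) : b ∈ M_a}). -/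
noncomputable section

open MeasureTheory Matrix Pointwise

/-- The set of natural numbers not representable as a nonnegative integer
combination of the coordinates of `a`. -/
def nonRepresentable (d : ℕ) (a : Fin d → ℤ) : Set ℕ :=
  {m : ℕ | ¬ ∃ k : Fin d → ℕ, (m : ℤ) = ∑ i, (k i : ℤ) * a i}

/-- The Frobenius number `F(a)`: the largest natural number not representable
as a nonnegative integer combination of the coordinates of `a`. -/
def frobNum (d : ℕ) (a : Fin d → ℤ) : ℕ := sSup (nonRepresentable d a)

/-- `ζ(d) = ∑_{n ≥ 1} n^{-d}`. -/
def zetaVal (d : ℕ) : ℝ := ∑' k : ℕ, 1 / ((k : ℝ) + 1) ^ d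

/-- Bézout's identity for a family of integers. -/
lemma exists_sum_mul_eq_one {d : ℕ} {a : Fin d → ℤ} (hgcd : Finset.univ.gcd a = 1) :
    ∃ u : Fin d → ℤ, ∑ i, u i * a i = 1 := by
  obtain ⟨u, hu⟩ := Finset.gcd_eq_sum_mul Finset.univ a
  exact ⟨u, by rw [← hgcd, hu]; exact Finset.sum_congr rfl fun i _ => mul_comm _ _⟩

/-- Every residue class modulo the last coordinate is attained by a combination of the others. -/
lemma exists_last_dvd_sub {e : ℕ} {a : Fin (e + 1) → ℤ} (hgcd : Finset.univ.gcd a = 1) (m : ℤ) :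
    ∃ c : Fin e → ℤ, a (Fin.last e) ∣ m - ∑ i, c i * a i.castSucc := by
  obtain ⟨u, hu⟩ := exists_sum_mul_eq_one hgcd
  rw [Fin.sum_univ_castSucc] at hu
  refine ⟨fun i => m * u i.castSucc, m * u (Fin.last e), ?_⟩
  simp only [mul_assoc, ← Finset.mul_sum]
  linear_combination (-m) * hu

lemma bddAbove_nonRepresentable {e : ℕ} {a : Fin (e + 1) → ℤ} (hgcd : Finset.univ.gcd a = 1)
    (hpos : ∀ i, 0 < a i) : BddAbove (nonRepresentable (e + 1) a) := by
  refine ⟨(∑ i : Fin e, a (Fin.last e) * a i.castSucc).toNat, fun m hm => ?_⟩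
  by_contra! hlt
  apply hm
  obtain ⟨c, hc⟩ := exists_last_dvd_sub hgcd m
  set q := a (Fin.last e)
  have hq : 0 < q := hpos _
  have hdvd : q ∣ (m : ℤ) - ∑ i : Fin e, c i % q * a i.castSucc := by
    have : (m : ℤ) - ∑ i : Fin e, c i % q * a i.castSucc
        = ((m : ℤ) - ∑ i : Fin e, c i * a i.castSucc)
          + q * ∑ i : Fin e, c i / q * a i.castSucc := by
      rw [sub_add, Finset.mul_sum, ← Finset.sum_sub_distrib]
      congr 1
      refine Finset.sum_congr rfl fun i _ => ?_
      linear_combination a i.castSucc * Int.emod_add_mul_ediv (c i) q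
    rw [this]
    exact hc.add (dvd_mul_right _ _)
  have hle : ∑ i : Fin e, c i % q * a i.castSucc ≤ ∑ i : Fin e, q * a i.castSucc :=
    Finset.sum_le_sum fun i _ =>
      mul_le_mul_of_nonneg_right (Int.emod_lt_of_pos _ hq).le (hpos _).le
  obtain ⟨z, hz⟩ := hdvd
  have hz0 : 0 ≤ z := by
    refine nonneg_of_mul_nonneg_right (?_ : 0 ≤ q * z) hq
    omega
  refine ⟨Fin.snoc (fun i => (c i % q).toNat) z.toNat, ?_⟩
  rw [Fin.sum_univ_castSucc]
  simp only [Fin.snoc_castSucc, Fin.snoc_last, Int.toNat_of_nonneg hz0,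
    Int.toNat_of_nonneg (Int.emod_nonneg _ hq.ne')]
  linear_combination hz

lemma one_mem_nonRepresentable {d : ℕ} {a : Fin d → ℤ} (h2 : ∀ i, 2 ≤ a i) :
    1 ∈ nonRepresentable d a := by
  rintro ⟨k, hk⟩
  by_cases h : ∀ i, k i = 0
  · simp [h] at hk
  · push Not at h
    obtain ⟨i, hi⟩ := h
    have h1 : (k i : ℤ) * a i ≤ ∑ j, (k j : ℤ) * a j :=
      Finset.single_le_sum (f := fun j => (k j : ℤ) * a j)
        (fun j _ => mul_nonneg (Int.natCast_nonneg _) (by linarith [h2 j])) (Finset.mem_univ i)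
    have h3 : (1 : ℤ) ≤ k i := by exact_mod_cast Nat.one_le_iff_ne_zero.mpr hi
    push_cast at hk
    nlinarith [h2 i]

lemma frobNum_mem_nonRepresentable {e : ℕ} {a : Fin (e + 1) → ℤ}
    (hgcd : Finset.univ.gcd a = 1) (h2 : ∀ i, 2 ≤ a i) :
    frobNum (e + 1) a ∈ nonRepresentable (e + 1) a :=
  Nat.sSup_mem ⟨1, one_mem_nonRepresentable h2⟩
    (bddAbove_nonRepresentable hgcd fun i => by linarith [h2 i])

lemma exists_eq_sum_of_frobNum_lt {e : ℕ} {a : Fin (e + 1) → ℤ}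
    (hgcd : Finset.univ.gcd a = 1) (hpos : ∀ i, 0 < a i) {m : ℤ}
    (hm : (frobNum (e + 1) a : ℤ) < m) :
    ∃ k : Fin (e + 1) → ℕ, m = ∑ i, (k i : ℤ) * a i := by
  lift m to ℕ using by omega
  by_contra h
  have := le_csSup (bddAbove_nonRepresentable hgcd hpos) (show m ∈ nonRepresentable (e + 1) a from h)
  exact absurd this (by unfold frobNum at hm; omega)

/-- Every point lies above a lattice point at `ℓ¹`-distance at most `F(a) + ∑ aᵢ`. -/
lemma exists_lattice_point_le {e : ℕ} {a : Fin (e + 1) → ℤ}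
    (hgcd : Finset.univ.gcd a = 1) (hpos : ∀ i, 0 < a i) (x : Fin e → ℝ) :
    ∃ b : Fin e → ℤ, a (Fin.last e) ∣ ∑ i, a i.castSucc * b i ∧
      (∀ i, (a i.castSucc : ℝ) * b i ≤ x i) ∧
      ∑ i, (x i - (a i.castSucc : ℝ) * b i) ≤ frobNum (e + 1) a + ∑ i, (a i : ℝ) := by
  set q := a (Fin.last e) with hqdef
  set F := frobNum (e + 1) a
  have hq : 0 < q := hpos _
  have hposR : ∀ i : Fin e, (0 : ℝ) < a i.castSucc := fun i => by exact_mod_cast hpos _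
  set c : Fin e → ℤ := fun i => ⌊x i / a i.castSucc⌋
  have hc1 : ∀ i, (a i.castSucc : ℝ) * c i ≤ x i := fun i => by
    have := Int.floor_le (x i / a i.castSucc)
    rwa [le_div_iff₀ (hposR i), mul_comm] at this
  have hc2 : ∀ i, x i ≤ (a i.castSucc : ℝ) * c i + a i.castSucc := fun i => by
    have := (Int.lt_floor_add_one (x i / a i.castSucc)).le
    rw [div_le_iff₀ (hposR i)] at this
    linarith
  set s := ∑ i, a i.castSucc * c i with hs
  set r := (s - F - 1) % q with hr
  have hr0 : 0 ≤ r := Int.emod_nonneg _ hq.ne'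
  have hrq : r < q := Int.emod_lt_of_pos _ hq
  obtain ⟨k, hk⟩ := exists_eq_sum_of_frobNum_lt hgcd hpos (m := F + 1 + r) (by omega)
  rw [Fin.sum_univ_castSucc, ← hqdef] at hk
  refine ⟨fun i => c i - k i.castSucc, ?_, fun i => ?_, ?_⟩
  · have hsum : ∑ i : Fin e, a i.castSucc * (c i - k i.castSucc)
        = s - ∑ i : Fin e, (k i.castSucc : ℤ) * a i.castSucc := by
      rw [hs, ← Finset.sum_sub_distrib]
      exact Finset.sum_congr rfl fun i _ => by ring
    refine ⟨(s - F - 1) / q + k (Fin.last e), ?_⟩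
    rw [hsum]
    linear_combination hk - Int.emod_add_mul_ediv (s - F - 1) q
  · have : (0 : ℝ) ≤ a i.castSucc * k i.castSucc := by have := hposR i; positivity
    push_cast
    linarith [hc1 i]
  · have hkle : ∑ i : Fin e, (k i.castSucc : ℤ) * a i.castSucc ≤ F + q := by
      have : 0 ≤ (k (Fin.last e) : ℤ) * q := by positivity
      linarith
    have hkle' : ∑ i : Fin e, (k i.castSucc : ℝ) * a i.castSucc ≤ F + q := by exact_mod_cast hkle
    rw [Fin.sum_univ_castSucc, ← hqdef]
    calc ∑ i : Fin e, (x i - (a i.castSucc : ℝ) * ((c i - k i.castSucc : ℤ) : ℝ))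
        ≤ ∑ i : Fin e, ((a i.castSucc : ℝ) + k i.castSucc * a i.castSucc) :=
          Finset.sum_le_sum fun i _ => by push_cast; linarith [hc2 i]
      _ ≤ _ := by rw [Finset.sum_add_distrib]; linarith

/-- Some point is at `ℓ¹`-distance almost `F(a) + ∑ aᵢ` from all lattice points below it. -/
lemma exists_forall_lattice_point_le {e : ℕ} {a : Fin (e + 1) → ℤ}
    (hgcd : Finset.univ.gcd a = 1) (h2 : ∀ i, 2 ≤ a i) {δ : ℝ} (hδ : 0 < δ) :
    ∃ x : Fin e → ℝ, ∀ b : Fin e → ℤ, a (Fin.last e) ∣ ∑ i, a i.castSucc * b i →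
      (∀ i, (a i.castSucc : ℝ) * b i ≤ x i) →
      frobNum (e + 1) a + ∑ i, (a i : ℝ) - e * δ ≤ ∑ i, (x i - (a i.castSucc : ℝ) * b i) := by
  have hF := frobNum_mem_nonRepresentable hgcd h2
  set q := a (Fin.last e) with hqdef
  set F := frobNum (e + 1) a
  have hq : 0 < q := by linarith [h2 (Fin.last e)]
  obtain ⟨c, w, hw⟩ := exists_last_dvd_sub hgcd F
  refine ⟨fun i => a i.castSucc * c i + a i.castSucc - δ, fun b ⟨v, hv⟩ hb => ?_⟩
  have hbc : ∀ i, 0 ≤ c i - b i := fun i => by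
    have h0 : (0 : ℝ) < a i.castSucc := by exact_mod_cast (by linarith [h2 i.castSucc])
    have h1 : (a i.castSucc : ℝ) * b i < a i.castSucc * (c i + 1) := by linarith [hb i]
    have h3 : (b i : ℝ) < c i + 1 := lt_of_mul_lt_mul_left h1 h0.le
    have h4 : b i < c i + 1 := by exact_mod_cast h3
    omega
  have hsum : ∑ i : Fin e, a i.castSucc * (c i - b i) = F - q * (w + v) := by
    simp only [mul_sub, Finset.sum_sub_distrib, hv]
    simp only [mul_comm (c _)] at hw
    linear_combination -hw
  have hneg : w + v ≤ -1 := by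
    by_contra! hcon
    refine hF ⟨Fin.snoc (fun i => (c i - b i).toNat) (w + v).toNat, ?_⟩
    rw [Fin.sum_univ_castSucc]
    simp only [Fin.snoc_castSucc, Fin.snoc_last, Int.toNat_of_nonneg (hbc _),
      Int.toNat_of_nonneg (show 0 ≤ w + v by omega)]
    simp only [mul_comm (a _)] at hsum
    linear_combination -hsum
  have hge : F + q ≤ ∑ i : Fin e, a i.castSucc * (c i - b i) := by rw [hsum]; nlinarith
  have hge' : (F : ℝ) + q ≤ ∑ i : Fin e, (a i.castSucc : ℝ) * (c i - b i) := by exact_mod_cast hge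
  have hx : ∑ i : Fin e, ((a i.castSucc : ℝ) * c i + a i.castSucc - δ - a i.castSucc * b i)
      = ∑ i : Fin e, (a i.castSucc : ℝ) * (c i - b i) + ∑ i : Fin e, (a i.castSucc : ℝ)
        - e * δ := by
    have : (e : ℝ) * δ = ∑ _i : Fin e, δ := by simp
    rw [this, ← Finset.sum_add_distrib, ← Finset.sum_sub_distrib]
    exact Finset.sum_congr rfl fun i _ => by ring
  rw [hx, Fin.sum_univ_castSucc, ← hqdef]
  linarith

/-- Kannan; Aliev–Gruber: the Frobenius number in terms of the covering radius
of the standard simplex with respect to the (rescaled) lattice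
`{(a_1 b_1, …, a_{d-1} b_{d-1}) : b ∈ M_a}`.  Here `e = d - 1 ≥ 2`. -/
theorem kannan_aliev_gruber (e : ℕ) (he : 2 ≤ e) (a : Fin (e + 1) → ℤ)
    (hgcd : Finset.univ.gcd a = 1) (h2 : ∀ i, 2 ≤ a i)
    (hle : ∀ i : Fin e, a i.castSucc ≤ a (Fin.last e)) :
    ((frobNum (e + 1) a : ℝ) + ∑ i, (a i : ℝ)) / (∏ i, (a i : ℝ)) ^ (1 / (e : ℝ))
      = covRad e (simplexStd e)
          {x : Fin e → ℝ | ∃ b : Fin e → ℤ,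
            (a (Fin.last e)) ∣ (∑ i, a i.castSucc * b i) ∧
            x = fun i =>
              (∏ j, (a j : ℝ)) ^ (-(1 / (e : ℝ))) * ((a i.castSucc : ℝ) * (b i : ℝ))} := by
  have hpos : ∀ i, 0 < a i := fun i => by linarith [h2 i]
  have hP : 0 < ∏ j, (a j : ℝ) := Finset.prod_pos fun j _ => by exact_mod_cast hpos j
  set S : ℝ := (frobNum (e + 1) a : ℝ) + ∑ i, (a i : ℝ)
  have hS : 0 < S := by
    have : 0 < ∑ i, (a i : ℝ) :=
      Finset.sum_pos (fun i _ => by exact_mod_cast hpos i) Finset.univ_nonempty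
    positivity
  rw [div_eq_mul_inv, ← Real.rpow_neg hP.le]
  set l : ℝ := (∏ j, (a j : ℝ)) ^ (-(1 / (e : ℝ)))
  have hl : 0 < l := Real.rpow_pos_of_pos hP _
  unfold covRad
  symm
  apply IsLeast.csInf_eq
  refine ⟨⟨mul_pos hS hl, fun x => ?_⟩, fun t ⟨ht, hcov⟩ => ?_⟩
  · obtain ⟨b, hb, hbx, hsum⟩ := exists_lattice_point_le hgcd hpos fun i => x i / l
    refine ⟨fun i => (x i / l - a i.castSucc * b i) / S,
      ⟨fun i => div_nonneg (sub_nonneg.2 (hbx i)) hS.le, ?_⟩, _, ⟨b, hb, rfl⟩, ?_⟩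
    · rw [← Finset.sum_div]
      exact (div_le_one hS).2 hsum
    · ext i
      simp only [Pi.add_apply, Pi.smul_apply, smul_eq_mul]
      field_simp
      ring
  · have he0 : (0 : ℝ) < e := by exact_mod_cast (by omega : 0 < e)
    rw [← le_div_iff₀ hl]
    refine le_of_forall_pos_le_add fun ε hε => ?_
    obtain ⟨x, hx⟩ := exists_forall_lattice_point_le hgcd h2 (div_pos hε he0)
    obtain ⟨k, ⟨hk0, hk1⟩, _, ⟨b, hb, rfl⟩, hxk⟩ := hcov fun i => l * x i
    have hdiff : ∀ i, x i - a i.castSucc * b i = t / l * k i := fun i => by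
      have := congrFun hxk i
      simp only [Pi.add_apply, Pi.smul_apply, smul_eq_mul] at this
      field_simp
      linarith
    have htl : 0 < t / l := div_pos ht hl
    have key := hx b hb fun i => by
      have := mul_nonneg htl.le (hk0 i)
      linarith [hdiff i]
    simp only [hdiff, ← Finset.mul_sum] at key
    rw [mul_div_cancel₀ _ he0.ne'] at key
    linarith [mul_le_of_le_one_right htl.le hk1]
end
end

section
/- Let d ≥ 3 be an integer, T > 1 a real number, and x ∈ (0,1)^{d−1}. Then the following are equivalent: (1) there exist a real s > 1, a matrix A ∈ SL_{d−1}(ℝ), and a vector b ∈ ℝ^{d−1} such that D(T)·n(x)·ℤ^d = D(s)·k(A,b)·ℤ^d (equality of subsets of ℝ^d); (2) there exists a ∈ ℤ^d with gcd(a_1, …, a_d) = 1 and 0 < a_i < a_d < T for all i = 1, …, d−1, such that x_i = a_i/a_d for all i = 1, …, d−1. (This identifies the Farey points a/T with a ∈ T𝒟₀ ∩ primitive ℤ^d, 𝒟₀ = {y ∈ ℝ^d : 0 < y_i < y_d < 1}, as exactly the points x of the cube for which the translated horosphere point D(T)n(x)Γ lies on the submanifold Λ = {D(s)kΓ : s >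 1, k ∈ K}.) -/
noncomputable section

open MeasureTheory Matrix Pointwise

/-- `â = (a_1/a_d, …, a_{d-1}/a_d)` for `a ∈ ℤ^d`, `d = e + 1`. -/
def aHat (e : ℕ) (a : Fin (e + 1) → ℤ) : Fin e → ℝ :=
  fun i => (a i.castSucc : ℝ) / (a (Fin.last e) : ℝ)

/-- `D(s) = diag(s^{-1/(d-1)}, …, s^{-1/(d-1)}, s)`, `d = e + 1`. -/
def dMat (e : ℕ) (s : ℝ) : Matrix (Fin (e + 1)) (Fin (e + 1)) ℝ :=
  Matrix.diagonal fun i => if i = Fin.last e then s else s ^ (-(1 / (e : ℝ)))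

/-- `n(x)`: the identity matrix except that the last row is `(x_1, …, x_{d-1}, 1)`. -/
def nMat (e : ℕ) (x : Fin e → ℝ) : Matrix (Fin (e + 1)) (Fin (e + 1)) ℝ :=
  Matrix.of fun i j =>
    if i = Fin.last e then
      (if hj : j = Fin.last e then 1 else x (j.castPred hj))
    else (if i = j then 1 else 0)

/-- `m(y) = diag(m'(y), 1)` where `m'(y) = (y_1⋯y_{d-1})^{-1/(d-1)}·diag(y)`. -/
def mMat (e : ℕ) (y : Fin e → ℝ) : Matrix (Fin (e + 1)) (Fin (e + 1)) ℝ :=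
  Matrix.diagonal fun i =>
    if hi : i = Fin.last e then 1
    else (∏ j, y j) ^ (-(1 / (e : ℝ))) * y (i.castPred hi)

/-- `k(A, b)`: the block matrix with upper-left block `A`, upper-right column `b`,
lower-left row `0` and lower-right entry `1`. -/
def kMat (e : ℕ) (A : Matrix (Fin e) (Fin e) ℝ) (b : Fin e → ℝ) :
    Matrix (Fin (e + 1)) (Fin (e + 1)) ℝ :=
  Matrix.of fun i j =>
    if hi : i = Fin.last e then (if j = Fin.last e then 1 else 0)
    else (if hj : j = Fin.last e then b (i.castPred hi)
          else A (i.castPred hi) (j.castPred hj))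

/-- A lattice is unchanged when its basis matrix is multiplied by a unimodular integer matrix. -/
theorem matLattice_mul_intCast {n : ℕ} (M : Matrix (Fin n) (Fin n) ℝ)
    (P : Matrix (Fin n) (Fin n) ℤ) (hP : P.det = 1) :
    matLattice (M * P.map (Int.cast : ℤ → ℝ)) = matLattice M := by
  have hcast : ∀ (Q : Matrix (Fin n) (Fin n) ℤ) (v : Fin n → ℤ),
      (fun i => ((Q *ᵥ v) i : ℝ)) = Q.map (Int.cast : ℤ → ℝ) *ᵥ fun i => (v i : ℝ) := by
    intro Q v
    ext i
    simp [mulVec, dotProduct]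
  ext y
  constructor
  · rintro ⟨v, rfl⟩
    exact ⟨P *ᵥ v, by rw [hcast, mulVec_mulVec]⟩
  · rintro ⟨v, rfl⟩
    refine ⟨P.adjugate *ᵥ v, ?_⟩
    rw [← mulVec_mulVec, ← hcast, mulVec_mulVec, mul_adjugate, hP, one_smul, one_mulVec]

/-- A primitive integer vector is carried to the last coordinate vector by a matrix in `SL_d(ℤ)`. -/
theorem exists_det_eq_one_vecMul_eq_single {e : ℕ} (he : e ≠ 0) (a : Fin (e + 1) → ℤ)
    (ha : Finset.univ.gcd a = 1) :
    ∃ P : Matrix (Fin (e + 1)) (Fin (e + 1)) ℤ, P.det = 1 ∧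
      a ᵥ* P = Pi.single (Fin.last e) 1 := by
  obtain ⟨w, hw⟩ := Finset.gcd_eq_sum_mul Finset.univ a
  rw [ha] at hw
  let f : (Fin (e + 1) → ℤ) →ₗ[ℤ] ℤ := dotProductBilin ℤ ℤ a
  have hf : ∀ v, f v = a ⬝ᵥ v := fun v => rfl
  have hfw : f w = 1 := by
    rw [hf, dotProduct, hw]
  obtain ⟨n, b⟩ := Submodule.basisOfPid (Pi.basisFun ℤ (Fin (e + 1))) (LinearMap.ker f)
  let c := Module.Basis.mkFinSnoc b w
    (fun r v hv h => by
      have := congrArg f h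
      rwa [map_add, map_smul, hfw, LinearMap.mem_ker.mp hv, map_zero, smul_eq_mul, mul_one,
        add_zero] at this)
    (fun z => ⟨-f z, by
      rw [LinearMap.mem_ker, map_add, map_smul, hfw, smul_eq_mul, mul_one, add_neg_cancel]⟩)
  have hn : n = e := by
    have := Module.finrank_eq_card_basis c
    simp at this
    omega
  subst hn
  have hc : ⇑c = Fin.snoc ((↑) ∘ b) w := Module.Basis.coe_mkFinSnoc _ _ _ _
  have hfc : ∀ j, f (c j) = Pi.single (M := fun _ => ℤ) (Fin.last n) 1 j := by
    intro j
    rw [hc]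
    induction j using Fin.lastCases with
    | last => simp [hfw]
    | cast j => simp [Fin.castSucc_ne_last]
  let P := (Pi.basisFun ℤ (Fin (n + 1))).toMatrix c
  have hPu : IsUnit P.det := by
    rw [← Module.Basis.det_apply]
    exact Module.Basis.isUnit_det _ c
  have haP : a ᵥ* P = Pi.single (Fin.last n) 1 := by
    ext j
    rw [← hfc, hf]
    simp [P, vecMul, Module.Basis.toMatrix, dotProduct]
  have h0 : (0 : Fin (n + 1)) ≠ Fin.last n := by
    simpa [Fin.ext_iff] using he.symm
  refine ⟨P * diagonal (Pi.mulSingle 0 P.det), ?_, ?_⟩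
  · rw [det_mul, det_diagonal, Finset.prod_pi_mulSingle']
    simpa using Int.isUnit_mul_self hPu
  · rw [← vecMul_vecMul, haP]
    ext j
    rw [vecMul_diagonal]
    by_cases hj : j = Fin.last n
    · subst hj
      simp [Pi.mulSingle_eq_of_ne h0.symm]
    · simp [Pi.single_eq_of_ne hj]

theorem det_dMat {e : ℕ} (he : e ≠ 0) {s : ℝ} (hs : 0 < s) : (dMat e s).det = 1 := by
  have he' : (e : ℝ) ≠ 0 := by exact_mod_cast he
  rw [dMat, det_diagonal, Fin.prod_univ_castSucc]
  simp only [Fin.castSucc_ne_last, if_false, if_true, Finset.prod_const, Finset.card_univ,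
    Fintype.card_fin]
  rw [← Real.rpow_natCast, ← Real.rpow_mul hs.le]
  simp [he', Real.rpow_neg_one, hs.ne']

theorem det_nMat (e : ℕ) (x : Fin e → ℝ) : (nMat e x).det = 1 := by
  rw [det_of_isLowerTriangular]
  · refine Finset.prod_eq_one fun i _ => ?_
    simp only [nMat, of_apply]
    split_ifs <;> simp_all
  · intro i j hij
    have hij : i < j := hij
    simp [nMat, (hij.trans_le (Fin.le_last j)).ne, hij.ne]

theorem det_kMat (e : ℕ) (A : Matrix (Fin e) (Fin e) ℝ) (b : Fin e → ℝ) :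
    (kMat e A b).det = A.det := by
  rw [det_succ_row _ (Fin.last e), Fin.sum_univ_castSucc, Finset.sum_eq_zero]
  · have : (kMat e A b).submatrix (Fin.last e).succAbove (Fin.last e).succAbove = A := by
      ext i j
      simp [kMat, Fin.castSucc_ne_last]
    rw [this]
    simp [kMat, ← two_mul]
  · intro j _
    simp [kMat, Fin.castSucc_ne_last]

theorem dMat_mul_apply_last (e : ℕ) (s : ℝ) (M : Matrix (Fin (e + 1)) (Fin (e + 1)) ℝ)
    (j : Fin (e + 1)) : (dMat e s * M) (Fin.last e) j = s * M (Fin.last e) j := by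
  simp [dMat, diagonal_mul]

theorem nMat_last_castSucc (e : ℕ) (x : Fin e → ℝ) (i : Fin e) :
    nMat e x (Fin.last e) i.castSucc = x i := by
  simp [nMat, Fin.castSucc_ne_last]

theorem nMat_last_last (e : ℕ) (x : Fin e → ℝ) :
    nMat e x (Fin.last e) (Fin.last e) = 1 := by
  simp [nMat]

theorem dMat_mul_kMat_mulVec_last (e : ℕ) (s : ℝ) (A : Matrix (Fin e) (Fin e) ℝ) (b : Fin e → ℝ)
    (v : Fin (e + 1) → ℝ) :
    ((dMat e s * kMat e A b) *ᵥ v) (Fin.last e) = s * v (Fin.last e) := by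
  simp only [mulVec, dotProduct, dMat_mul_apply_last]
  simp [kMat]

/-- A matrix whose last row is `(0, …, 0, s)` has the form `D(s)k(A, b)`. -/
theorem exists_eq_dMat_mul_kMat {e : ℕ} {s : ℝ} (hs : 0 < s)
    (M : Matrix (Fin (e + 1)) (Fin (e + 1)) ℝ)
    (hM : ∀ j, M (Fin.last e) j = if j = Fin.last e then s else 0) :
    ∃ A b, M = dMat e s * kMat e A b := by
  have hr : s ^ (-(1 / (e : ℝ))) ≠ 0 := (Real.rpow_pos_of_pos hs _).ne'
  refine ⟨of fun i j => (s ^ (-(1 / (e : ℝ))))⁻¹ * M i.castSucc j.castSucc,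
    fun i => (s ^ (-(1 / (e : ℝ))))⁻¹ * M i.castSucc (Fin.last e), ?_⟩
  ext i j
  rw [dMat, diagonal_mul]
  induction i using Fin.lastCases with
  | last => simp [kMat, hM]
  | cast i =>
    induction j using Fin.lastCases with
    | last => simp only [kMat, of_apply, Fin.castSucc_ne_last, if_false, dite_false, dite_true,
        Fin.castPred_castSucc, mul_inv_cancel_left₀ hr]
    | cast j => simp only [kMat, of_apply, Fin.castSucc_ne_last, if_false, dite_false,
        Fin.castPred_castSucc, mul_inv_cancel_left₀ hr]

/-- Identification of Farey points: for `x` in the open unit cube and `T > 1`,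
the translated horosphere point `D(T)n(x)ℤ^d` lies on the submanifold
`Λ = {D(s)kΓ : s > 1, k ∈ K}` if and only if `x = â` for some primitive
`a ∈ T𝒟₀ ∩ ℤ^d`, `𝒟₀ = {y : 0 < y_i < y_d < 1}`.  Here `e = d - 1 ≥ 2`. -/
theorem farey_points_on_Lambda (e : ℕ) (he : 2 ≤ e) (T : ℝ) (hT : 1 < T)
    (x : Fin e → ℝ) (hx : ∀ i, 0 < x i ∧ x i < 1) :
    (∃ s : ℝ, 1 < s ∧ ∃ A : Matrix (Fin e) (Fin e) ℝ, A.det = 1 ∧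
        ∃ b : Fin e → ℝ,
          matLattice (dMat e T * nMat e x) = matLattice (dMat e s * kMat e A b))
      ↔ (∃ a : Fin (e + 1) → ℤ, Finset.univ.gcd a = 1 ∧
          (∀ i : Fin e, 0 < a i.castSucc ∧ a i.castSucc < a (Fin.last e)) ∧
          ((a (Fin.last e) : ℝ) < T) ∧
          (∀ i : Fin e, x i = (a i.castSucc : ℝ) / (a (Fin.last e) : ℝ))) := by
  constructor
  · rintro ⟨s, hs, A, -, b, h⟩
    have hs0 : 0 < s := one_pos.trans hs
    have hrow : ∀ j, ∃ m : ℤ, T * nMat e x (Fin.last e) j = s * m := by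
      intro j
      have hmem : (dMat e T * nMat e x) *ᵥ (fun i => ((Pi.single j 1 : Fin (e + 1) → ℤ) i : ℝ)) ∈
          matLattice (dMat e s * kMat e A b) := h ▸ ⟨_, rfl⟩
      obtain ⟨v, hv⟩ := hmem
      refine ⟨v (Fin.last e), ?_⟩
      have := congrFun hv (Fin.last e)
      rw [dMat_mul_kMat_mulVec_last] at this
      rw [← this, ← dMat_mul_apply_last]
      simp [mulVec, dotProduct, Pi.single_apply]
    choose a ha using hrow
    have hlast : T = s * a (Fin.last e) := by simpa [nMat_last_last] using ha (Fin.last e)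
    have hcast : ∀ i : Fin e, T * x i = s * a i.castSucc := fun i => by
      simpa [nMat_last_castSucc] using ha i.castSucc
    have hpos : (0 : ℝ) < a (Fin.last e) := by
      have : 0 < s * a (Fin.last e) := by rw [← hlast]; linarith
      exact pos_of_mul_pos_right this hs0.le
    have hxa : ∀ i : Fin e, x i = (a i.castSucc : ℝ) / (a (Fin.last e) : ℝ) := by
      intro i
      rw [eq_div_iff hpos.ne']
      apply mul_left_cancel₀ hs0.ne'
      rw [← hcast, hlast]
      ring
    refine ⟨a, ?_, fun i => ?_, ?_, hxa⟩
    · have hmem : (dMat e s * kMat e A b) *ᵥ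
          (fun i => ((Pi.single (Fin.last e) 1 : Fin (e + 1) → ℤ) i : ℝ)) ∈
          matLattice (dMat e T * nMat e x) := h ▸ ⟨_, rfl⟩
      obtain ⟨w, hw⟩ := hmem
      have hw := congrFun hw (Fin.last e)
      rw [dMat_mul_kMat_mulVec_last] at hw
      simp only [mulVec, dotProduct, dMat_mul_apply_last, ha, mul_assoc] at hw
      rw [← Finset.mul_sum] at hw
      have hsum : ∑ j, a j * w j = 1 := by
        have := mul_left_cancel₀ hs0.ne' hw
        simp only [Pi.single_eq_same] at this
        exact_mod_cast this.symm
      have hdvd : Finset.univ.gcd a ∣ 1 := by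
        rw [← hsum]
        exact Finset.dvd_sum fun j hj => (Finset.gcd_dvd hj).mul_right _
      rw [← Finset.normalize_gcd]
      exact normalize_eq_one.mpr (isUnit_of_dvd_one hdvd)
    · obtain ⟨h0, h1⟩ := hx i
      rw [hxa i] at h0 h1
      rw [div_lt_one hpos] at h1
      rw [div_pos_iff_of_pos_right hpos] at h0
      exact ⟨by exact_mod_cast h0, by exact_mod_cast h1⟩
    · rw [hlast]
      exact lt_mul_of_one_lt_left hpos hs
  · rintro ⟨a, hgcd, hlt, haT, hxa⟩
    have he0 : e ≠ 0 := by omega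
    have hT0 : 0 < T := one_pos.trans hT
    have hpos : (0 : ℝ) < a (Fin.last e) := by
      have := hlt ⟨0, by omega⟩
      exact_mod_cast this.1.trans this.2
    have hs : 1 < T / a (Fin.last e) := (one_lt_div hpos).mpr haT
    generalize hsdef : T / (a (Fin.last e) : ℝ) = s at hs
    have hs0 : 0 < s := one_pos.trans hs
    have hTs : T = s * a (Fin.last e) := by rw [← hsdef, div_mul_cancel₀ _ hpos.ne']
    have hrow : ∀ j, T * nMat e x (Fin.last e) j = s * a j := by
      intro j
      induction j using Fin.lastCases with
      | last => rw [nMat_last_last, hTs, mul_one]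
      | cast i =>
        rw [nMat_last_castSucc, hxa, hTs]
        field_simp
    obtain ⟨P, hP, haP⟩ := exists_det_eq_one_vecMul_eq_single he0 a hgcd
    obtain ⟨A, b, hAb⟩ := exists_eq_dMat_mul_kMat hs0
      (dMat e T * nMat e x * P.map (Int.cast : ℤ → ℝ)) (fun j => by
        rw [Matrix.mul_apply]
        simp only [dMat_mul_apply_last, hrow, mul_assoc, Matrix.map_apply]
        rw [← Finset.mul_sum]
        have := congrFun haP j
        simp only [vecMul, dotProduct, Pi.single_apply] at this
        have : ∑ k, (a k : ℝ) * (P k j : ℝ) = if j = Fin.last e then 1 else 0 := by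
          exact_mod_cast this
        rw [this, mul_ite, mul_one, mul_zero])
    have hPdet : (P.map (Int.cast : ℤ → ℝ)).det = 1 := by
      rw [← Int.cast_det, hP, Int.cast_one]
    refine ⟨s, hs, A, ?_, b, ?_⟩
    · have := congrArg det hAb
      rw [det_mul, det_mul, det_mul, det_dMat he0 hT0, det_dMat he0 hs0, det_nMat, det_kMat,
        hPdet] at this
      linarith
    · rw [← hAb, matLattice_mul_intCast _ _ hP]
end
end

section
/- Let d ≥ 2 be an integer and M ≥ 1 a real number. Let A_1, A_2 ∈ SL_{d−1}(ℝ) and b_1, b_2 ∈ ℝ^{d−1} be such that every entry of A_1, A_2, b_1, b_2 has absolute value at most M. Let x ∈ ℝ^{d−1} with Euclidean norm ‖x‖ < 1/(2Md), and let T ≥ 1 be real. If n(x)·D(T)·k(A_1,b_1)·ℤ^d = k(A_2,b_2)·ℤ^d (equality of subsets of ℝ^d), then x = 0 and T = 1 (and consequently k(A_1,b_1)·ℤ^d = k(A_2,b_2)·ℤ^d). (This is the key injectivity estimate showing that compact subsets of KΓ/Γ have positive injectivity radius along the expanding horospherical subgroup.) -/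
noncomputable section

open MeasureTheory Matrix Pointwise

theorem kMat_mulVec_last (e : ℕ) (A : Matrix (Fin e) (Fin e) ℝ) (b : Fin e → ℝ)
    (v : Fin (e + 1) → ℝ) : (kMat e A b *ᵥ v) (Fin.last e) = v (Fin.last e) := by
  simp [kMat, Matrix.mulVec, dotProduct]

theorem nMat_zero (e : ℕ) : nMat e 0 = 1 := by
  ext i j
  by_cases hi : i = Fin.last e
  · subst hi
    by_cases hj : j = Fin.last e
    · subst hj
      simp [nMat]
    · simp [nMat, hj, Matrix.one_apply_ne' hj]
  · simp [nMat, hi, Matrix.one_apply]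

/-- The last row of `n(x) D(s) k(A, b)`, away from the corner. -/
theorem nMat_mul_dMat_mul_kMat_last_castSucc (e : ℕ) (x : Fin e → ℝ) (s : ℝ)
    (A : Matrix (Fin e) (Fin e) ℝ) (b : Fin e → ℝ) (j : Fin e) :
    (nMat e x * dMat e s * kMat e A b) (Fin.last e) j.castSucc
      = s ^ (-(1 / (e : ℝ))) * (x ᵥ* A) j := by
  rw [Matrix.mul_apply, Fin.sum_univ_castSucc, Matrix.vecMul, dotProduct, Finset.mul_sum]
  simp only [dMat, Matrix.mul_diagonal]
  simp [nMat, kMat, mul_comm, mul_left_comm, mul_assoc]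

/-- Every point of `k(A, b) ℤ^d` has an integral last coordinate. -/
theorem exists_int_of_mem_matLattice_kMat {e : ℕ} {A : Matrix (Fin e) (Fin e) ℝ}
    {b : Fin e → ℝ} {p : Fin (e + 1) → ℝ} (hp : p ∈ matLattice (kMat e A b)) :
    ∃ n : ℤ, p (Fin.last e) = n := by
  obtain ⟨v, rfl⟩ := hp
  exact ⟨v (Fin.last e), kMat_mulVec_last ..⟩

theorem col_mem_matLattice {n : ℕ} (N : Matrix (Fin n) (Fin n) ℝ) (j : Fin n) :
    N.col j ∈ matLattice N := by
  refine ⟨Pi.single j 1, ?_⟩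
  rw [← Matrix.mulVec_single_one]
  congr 1
  ext i
  by_cases h : i = j <;> simp [h]

theorem abs_vecMul_le {m n : ℕ} {A : Matrix (Fin m) (Fin n) ℝ} {M : ℝ}
    (hA : ∀ i j, |A i j| ≤ M) (x : Fin m → ℝ) (j : Fin n) :
    |(x ᵥ* A) j| ≤ m * (Real.sqrt (∑ i, x i ^ 2) * M) := by
  calc |∑ i, x i * A i j| ≤ ∑ i, |x i * A i j| := Finset.abs_sum_le_sum_abs _ _
    _ ≤ ∑ _i : Fin m, Real.sqrt (∑ i, x i ^ 2) * M := by
        refine Finset.sum_le_sum fun i _ => ?_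
        rw [abs_mul]
        have hxi : |x i| ≤ Real.sqrt (∑ i, x i ^ 2) :=
          Real.abs_le_sqrt
            (Finset.single_le_sum (f := fun i => x i ^ 2) (fun i _ => sq_nonneg (x i))
              (Finset.mem_univ i))
        exact mul_le_mul hxi (hA i j) (abs_nonneg _) (Real.sqrt_nonneg _)
    _ = m * (Real.sqrt (∑ i, x i ^ 2) * M) := by simp

/-- Key injectivity estimate: if the entries of `A₁, A₂, b₁, b₂` are bounded by
`M`, `‖x‖ < 1/(2Md)` and `T ≥ 1`, then `n(x)D(T)k(A₁,b₁)ℤ^d = k(A₂,b₂)ℤ^d`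
forces `x = 0` and `T = 1`.  Here `e = d - 1 ≥ 1`. -/
theorem horospherical_injectivity (e : ℕ) (he : 1 ≤ e) (M : ℝ) (hM : 1 ≤ M)
    (A₁ A₂ : Matrix (Fin e) (Fin e) ℝ) (hA₁ : A₁.det = 1) (hA₂ : A₂.det = 1)
    (b₁ b₂ : Fin e → ℝ)
    (hA₁M : ∀ i j, |A₁ i j| ≤ M) (hA₂M : ∀ i j, |A₂ i j| ≤ M)
    (hb₁M : ∀ i, |b₁ i| ≤ M) (hb₂M : ∀ i, |b₂ i| ≤ M)
    (x : Fin e → ℝ) (hx : Real.sqrt (∑ i, x i ^ 2) < 1 / (2 * M * (e + 1)))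
    (T : ℝ) (hT : 1 ≤ T)
    (hlat : matLattice (nMat e x * dMat e T * kMat e A₁ b₁)
              = matLattice (kMat e A₂ b₂)) :
    x = 0 ∧ T = 1 := by
  have hT0 : 0 < T := by linarith
  have hs0 : 0 < T ^ (-(1 / (e : ℝ))) := Real.rpow_pos_of_pos hT0 _
  have hs1 : T ^ (-(1 / (e : ℝ))) ≤ 1 :=
    Real.rpow_le_one_of_one_le_of_nonpos hT (neg_nonpos.mpr (by positivity))
  have hsmall : (e : ℝ) * (Real.sqrt (∑ i, x i ^ 2) * M) < 1 := by
    rw [lt_div_iff₀ (by positivity)] at hx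
    have h := mul_nonneg (Real.sqrt_nonneg (∑ i, x i ^ 2)) (by linarith : (0 : ℝ) ≤ M)
    have he' := mul_nonneg (Nat.cast_nonneg (α := ℝ) e) h
    linarith
  have hxA : x ᵥ* A₁ = 0 := by
    ext j
    obtain ⟨n, hn⟩ := exists_int_of_mem_matLattice_kMat
      (hlat ▸ col_mem_matLattice (nMat e x * dMat e T * kMat e A₁ b₁) j.castSucc)
    rw [Matrix.col_apply, nMat_mul_dMat_mul_kMat_last_castSucc] at hn
    have hlt : |(n : ℝ)| < 1 := by
      rw [← hn, abs_mul, abs_of_pos hs0]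
      exact (mul_le_of_le_one_left (abs_nonneg _) hs1).trans_lt
        ((abs_vecMul_le hA₁M x j).trans_lt hsmall)
    have hn0 : n = 0 := Int.abs_lt_one_iff.mp (by exact_mod_cast hlt)
    rw [hn0, Int.cast_zero] at hn
    exact (mul_eq_zero.mp hn).resolve_left hs0.ne'
  have hx0 : x = 0 := Matrix.eq_zero_of_vecMul_eq_zero (by simp [hA₁]) hxA
  refine ⟨hx0, ?_⟩
  obtain ⟨v, hv⟩ := hlat.symm ▸ col_mem_matLattice (kMat e A₂ b₂) (Fin.last e)
  have h1 := congrFun hv (Fin.last e)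
  rw [hx0, nMat_zero, one_mul, ← Matrix.mulVec_mulVec, dMat, Matrix.mulVec_diagonal,
    kMat_mulVec_last] at h1
  have hTv : 1 = T * (v (Fin.last e) : ℝ) := by simpa [kMat] using h1
  have hvpos : (0 : ℝ) < v (Fin.last e) := by
    by_contra! h
    linarith [mul_nonpos_of_nonneg_of_nonpos hT0.le h]
  have hv1 : (1 : ℝ) ≤ v (Fin.last e) := by
    exact_mod_cast Int.cast_pos.mp hvpos
  nlinarith
end
end

section
/- Let d ≥ 3 be an integer, T > 1 a real number, and r ∈ (0,1). Then #{a ∈ ℤ^d : 0 < a_i < a_d for all i = 1, …, d−1, a_d < T, and there exists i ∈ {1, …, d−1} with a_i ≤ r·a_d or a_i ≥ (1−r)·a_d} ≤ 2(d−1)·r·T^d. (This is the counting estimate showing that the number of lattice points in T𝒟₀, 𝒟₀ = {y : 0 < y_i < y_d < 1}, whose Farey point (a_1/a_d, …, a_{d−1}/a_d) lies within distance r of the boundary of the unit cube, is O(T^d r).) -/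
noncomputable section

open MeasureTheory Matrix Pointwise

/-- The integer points of `[1, T] ^ n` whose `p`-th coordinate is at most `x`. -/
def thinBox {n : ℕ} (T x : ℝ) (p : Fin n) : Finset (Fin n → ℤ) :=
  Fintype.piFinset fun j => if j = p then Finset.Icc 1 ⌊x⌋ else Finset.Icc 1 ⌊T⌋

theorem mem_thinBox {n : ℕ} {T x : ℝ} {p : Fin n} {a : Fin n → ℤ}
    (hpos : ∀ j, 0 < a j) (hT : ∀ j, (a j : ℝ) ≤ T) (hx : (a p : ℝ) ≤ x) :
    a ∈ thinBox T x p := by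
  refine Fintype.mem_piFinset.2 fun j => ?_
  split_ifs with h
  · subst h
    exact Finset.mem_Icc.2 ⟨hpos j, Int.le_floor.2 hx⟩
  · exact Finset.mem_Icc.2 ⟨hpos j, Int.le_floor.2 (hT j)⟩

theorem card_Icc_one_floor_le {x : ℝ} (hx : 0 ≤ x) :
    ((Finset.Icc 1 ⌊x⌋).card : ℝ) ≤ x := by
  rw [Int.card_Icc, add_sub_cancel_right, Int.floor_toNat]
  exact Nat.floor_le hx

theorem card_thinBox_le {n : ℕ} {T x : ℝ} (hT : 0 ≤ T) (hx : 0 ≤ x) (p : Fin (n + 1)) :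
    ((thinBox T x p).card : ℝ) ≤ x * T ^ n := by
  rw [thinBox, Fintype.card_piFinset, Fin.prod_univ_succAbove _ p]
  simp only [if_true, Fin.succAbove_ne, if_false, Finset.prod_const, Finset.card_univ,
    Fintype.card_fin]
  push_cast
  gcongr
  · exact card_Icc_one_floor_le hx
  · exact card_Icc_one_floor_le hT

/-- Reflect the `p`-th coordinate of `a` in the interval `[0, a q]`. -/
def reflectCoord {n : ℕ} (p q : Fin n) (a : Fin n → ℤ) : Fin n → ℤ :=
  Function.update a p (a q - a p)

theorem reflectCoord_reflectCoord {n : ℕ} {p q : Fin n} (h : q ≠ p) (a : Fin n → ℤ) :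
    reflectCoord p q (reflectCoord p q a) = a := by
  simp [reflectCoord, h]

/-- Counting estimate: the number of lattice points `a ∈ T𝒟₀ ∩ ℤ^d` whose Farey
point `(a_1/a_d, …, a_{d-1}/a_d)` lies within distance `r` of the boundary of
the unit cube is at most `2(d-1)·r·T^d`.  Here `e = d - 1 ≥ 2`. -/
theorem farey_boundary_count (e : ℕ) (he : 2 ≤ e) (T : ℝ) (hT : 1 < T)
    (r : ℝ) (hr0 : 0 < r) (hr1 : r < 1) :
    (Set.ncard {a : Fin (e + 1) → ℤ |
        (∀ i : Fin e, 0 < a i.castSucc ∧ a i.castSucc < a (Fin.last e)) ∧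
        ((a (Fin.last e) : ℝ) < T) ∧
        ∃ i : Fin e, (a i.castSucc : ℝ) ≤ r * (a (Fin.last e) : ℝ) ∨
          (1 - r) * (a (Fin.last e) : ℝ) ≤ (a i.castSucc : ℝ)} : ℝ)
      ≤ 2 * e * r * T ^ (e + 1) := by
  classical
  set q := Fin.last e
  have hT0 : 0 ≤ T := by linarith
  let F : Fin e → Finset (Fin (e + 1) → ℤ) := fun i =>
    thinBox T (r * T) i.castSucc ∪ (thinBox T (r * T) i.castSucc).image (reflectCoord i.castSucc q)
  have hF (i : Fin e) : ((F i).card : ℝ) ≤ 2 * (r * T * T ^ e) := by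
    have h := card_thinBox_le hT0 (by positivity : 0 ≤ r * T) i.castSucc
    have hc : (F i).card ≤ (thinBox T (r * T) i.castSucc).card +
        (thinBox T (r * T) i.castSucc).card :=
      (Finset.card_union_le _ _).trans (Nat.add_le_add_left Finset.card_image_le _)
    have hc' : ((F i).card : ℝ) ≤ (thinBox T (r * T) i.castSucc).card +
        (thinBox T (r * T) i.castSucc).card := mod_cast hc
    linarith
  calc
    _ ≤ ((Finset.univ.biUnion F).card : ℝ) := by
      rw [← Set.ncard_coe_finset]
      refine Nat.cast_le.2 (Set.ncard_le_ncard ?_ (Finset.finite_toSet _))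
      rintro a ⟨ha, haT, i, hi⟩
      refine Finset.mem_coe.2 (Finset.mem_biUnion.2 ⟨i, Finset.mem_univ _, Finset.mem_union.2 ?_⟩)
      have hpos : ∀ j, 0 < a j :=
        Fin.lastCases ((ha i).1.trans (ha i).2) fun j => (ha j).1
      have hle : ∀ j, a j ≤ a q := Fin.lastCases le_rfl fun j => (ha j).2.le
      have hleT (j : Fin (e + 1)) : (a j : ℝ) ≤ T := (Int.cast_le.2 (hle j)).trans haT.le
      have hrT : r * (a q : ℝ) ≤ r * T := mul_le_mul_of_nonneg_left haT.le hr0.le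
      refine hi.imp (fun h => mem_thinBox hpos hleT (h.trans hrT)) fun h => ?_
      refine Finset.mem_image.2 ⟨reflectCoord i.castSucc q a, ?_,
        reflectCoord_reflectCoord (Fin.castSucc_lt_last i).ne' a⟩
      have hb : 0 < a q - a i.castSucc := sub_pos.2 (ha i).2
      have hbr : ((a q - a i.castSucc : ℤ) : ℝ) ≤ r * T := by
        push_cast
        linarith
      refine mem_thinBox (fun j => ?_) (fun j => ?_) (by simpa [reflectCoord] using hbr)
      · obtain rfl | hj := eq_or_ne j i.castSucc
        · simpa [reflectCoord] using hb
        · simpa [reflectCoord, hj] using hpos j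
      · obtain rfl | hj := eq_or_ne j i.castSucc
        · have hrT' : r * T ≤ T := mul_le_of_le_one_left hT0 hr1.le
          simpa [reflectCoord] using hbr.trans hrT'
        · simpa [reflectCoord, hj] using hleT j
    _ ≤ ∑ i, ((F i).card : ℝ) := mod_cast Finset.card_biUnion_le
    _ ≤ ∑ _i : Fin e, 2 * (r * T * T ^ e) := Finset.sum_le_sum fun i _ => hF i
    _ = 2 * e * r * T ^ (e + 1) := by
      rw [Finset.sum_const, Finset.card_univ, Fintype.card_fin, nsmul_eq_mul]
      ring
end
end

section
/- Let X be a metric space, let α > 0 and C > 0, and let μ and (μ_T)_{T ≥ 1} be finite Borel measures on X. Suppose that for every bounded nonnegative Lipschitz function f : X → ℝ and every T ≥ 1, |∫_X f dμ_T − ∫_X f dμ| ≤ (sup|f| + Lip(f))·T^{−α}, where Lip(f) is the Lipschitz constant of f. Let E ⊆ X be an open set that is C-good with respect to μ, in the sense that for every r ∈ (0,1), μ({x ∈ E : dist(x, X∖E) < r}) + μ({x ∉ E : dist(x, E) < r}) < C·r. Then for every T > 1, |μ_T(E) − μ(E)| ≤ (C + 2)·T^{−α/2}. -/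
noncomputable section

open MeasureTheory

/-- A continuous function squeezed between the indicators of `A` and `B` has integral squeezed
between the measures of `A` and `B`. -/
theorem measureReal_le_integral_le_measureReal {X : Type*} [TopologicalSpace X]
    [MeasurableSpace X] [BorelSpace X] (ν : Measure X) [IsFiniteMeasure ν] {f : X → ℝ}
    (hf : Continuous f) (h0 : ∀ x, 0 ≤ f x) (h1 : ∀ x, f x ≤ 1) {A B : Set X}
    (hA : MeasurableSet A) (hB : MeasurableSet B)
    (hfA : ∀ x ∈ A, 1 ≤ f x) (hfB : ∀ x ∉ B, f x ≤ 0) :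
    ν.real A ≤ ∫ x, f x ∂ν ∧ ∫ x, f x ∂ν ≤ ν.real B := by
  have hint : Integrable f ν :=
    Integrable.of_bound hf.measurable.aestronglyMeasurable 1
      (.of_forall fun x => by rw [Real.norm_eq_abs, abs_of_nonneg (h0 x)]; exact h1 x)
  constructor
  · rw [← integral_indicator_one hA]
    refine integral_mono ((integrable_const 1).indicator hA) hint fun x => ?_
    by_cases hx : x ∈ A
    · simpa [hx] using hfA x hx
    · simpa [hx] using h0 x
  · rw [← integral_indicator_one hB]
    refine integral_mono hint ((integrable_const 1).indicator hB) fun x => ?_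
    by_cases hx : x ∈ B
    · simpa [hx] using h1 x
    · simpa [hx] using hfB x hx

/-- The distance to a set, rescaled by `r⁻¹`, is `r⁻¹`-Lipschitz. -/
theorem lipschitzWith_infDist_div {X : Type*} [PseudoMetricSpace X] (S : Set X) {r : ℝ}
    (hr : 0 < r) : LipschitzWith (Real.toNNReal r⁻¹) fun x => Metric.infDist x S / r := by
  refine LipschitzWith.of_dist_le_mul fun x y => ?_
  have h := (Metric.lipschitz_infDist_pt S).dist_le_mul x y
  rw [Real.coe_toNNReal _ (inv_nonneg.2 hr.le), Real.dist_eq, ← sub_div, abs_div,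
    abs_of_pos hr, div_eq_inv_mul]
  rw [NNReal.coe_one, one_mul, Real.dist_eq] at h
  exact mul_le_mul_of_nonneg_left h (inv_nonneg.2 hr.le)

/-- Effective equidistribution for indicator functions of "good" sets: if the
measures `μ_T` approximate `μ` with error `(sup|f| + Lip(f))·T^{-α}` on bounded
nonnegative Lipschitz functions, then for any open `C`-good set `E` one has
`|μ_T(E) − μ(E)| ≤ (C + 2)·T^{-α/2}`. -/
theorem good_sets_effective_equidistribution
    {X : Type*} [MetricSpace X] [MeasurableSpace X] [BorelSpace X]
    (α : ℝ) (hα : 0 < α) (C : ℝ) (hC : 0 < C)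
    (μ : Measure X) [IsFiniteMeasure μ]
    (μT : ℝ → Measure X) (hfin : ∀ T : ℝ, IsFiniteMeasure (μT T))
    (happrox : ∀ f : X → ℝ, (∀ x, 0 ≤ f x) → BddAbove (Set.range f) →
      ∀ K : NNReal, LipschitzWith K f →
        ∀ T : ℝ, 1 ≤ T →
          |(∫ x, f x ∂(μT T)) - ∫ x, f x ∂μ|
            ≤ ((⨆ x, f x) + (K : ℝ)) * T ^ (-α))
    (E : Set X) (hE : IsOpen E)
    (hgood : ∀ r : ℝ, 0 < r → r < 1 →
      μ {x | x ∈ E ∧ Metric.infDist x Eᶜ < r}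
        + μ {x | x ∉ E ∧ Metric.infDist x E < r} < ENNReal.ofReal (C * r)) :
    ∀ T : ℝ, 1 < T →
      |(μT T E).toReal - (μ E).toReal| ≤ (C + 2) * T ^ (-(α / 2)) := by
  intro T hT
  have := hfin T
  have hT0 : 0 < T := one_pos.trans hT
  set r : ℝ := T ^ (-(α / 2)) with hr
  have hr0 : 0 < r := Real.rpow_pos_of_pos hT0 _
  have hr1 : r < 1 := Real.rpow_lt_one_of_one_lt_of_neg hT (by linarith)
  have hrr : T ^ (-α) = r * r := by
    rw [hr, ← Real.rpow_add hT0]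
    congr 1
    ring
  have herr : ∀ f : X → ℝ, (∀ x, 0 ≤ f x) → (∀ x, f x ≤ 1) →
      LipschitzWith (Real.toNNReal r⁻¹) f →
      |(∫ x, f x ∂(μT T)) - ∫ x, f x ∂μ| ≤ 2 * r := by
    intro f h0 h1 hL
    refine (happrox f h0 ⟨1, Set.forall_mem_range.2 h1⟩ _ hL T hT.le).trans ?_
    rw [Real.coe_toNNReal _ (inv_nonneg.2 hr0.le), hrr]
    have hsup : ⨆ x, f x ≤ 1 := Real.iSup_le h1 zero_le_one
    calc ((⨆ x, f x) + r⁻¹) * (r * r) ≤ (1 + r⁻¹) * (r * r) := by gcongr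
      _ = r * r + r := by field_simp
      _ ≤ 2 * r := by nlinarith
  set inner : Set X := {x | x ∈ E ∧ Metric.infDist x Eᶜ < r}
  set outer : Set X := {x | x ∉ E ∧ Metric.infDist x E < r}
  have hEm : MeasurableSet E := hE.measurableSet
  have hinner_meas : MeasurableSet inner :=
    hEm.inter (measurableSet_lt (Metric.continuous_infDist_pt _).measurable measurable_const)
  have houter_meas : MeasurableSet outer :=
    hEm.compl.inter (measurableSet_lt (Metric.continuous_infDist_pt _).measurable measurable_const)
  have hthin : μ.real inner + μ.real outer ≤ C * r := by
    rw [measureReal_def, measureReal_def,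
      ← ENNReal.toReal_add (measure_ne_top _ _) (measure_ne_top _ _)]
    exact ENNReal.toReal_le_of_le_ofReal (by positivity) (hgood r hr0 hr1).le
  have hinner0 : 0 ≤ μ.real inner := measureReal_nonneg
  have houter0 : 0 ≤ μ.real outer := measureReal_nonneg
  change |(μT T).real E - μ.real E| ≤ _
  have hupper : (μT T).real E ≤ μ.real E + μ.real outer + 2 * r := by
    let f : X → ℝ := fun x => max (1 - Metric.infDist x E / r) 0
    have h0 : ∀ x, 0 ≤ f x := fun x => le_max_right _ _
    have h1 : ∀ x, f x ≤ 1 := fun x =>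
      max_le (sub_le_self _ (div_nonneg Metric.infDist_nonneg hr0.le)) zero_le_one
    have hL : LipschitzWith (Real.toNNReal r⁻¹) f := by
      have h := (LipschitzWith.const (1 : ℝ)).sub (lipschitzWith_infDist_div E hr0)
      rw [zero_add] at h
      exact h.max_const 0
    have hfE : ∀ x ∈ E, 1 ≤ f x := fun x hx => by
      simp [f, Metric.infDist_zero_of_mem hx]
    have hfout : ∀ x ∉ E ∪ outer, f x ≤ 0 := fun x hx => by
      rw [Set.mem_union, not_or] at hx
      have hxr : r ≤ Metric.infDist x E := not_lt.1 fun h => hx.2 ⟨hx.1, h⟩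
      exact max_le (sub_nonpos.2 ((one_le_div hr0).2 hxr)) le_rfl
    have hT' := (measureReal_le_integral_le_measureReal (μT T) hL.continuous h0 h1
      hEm (hEm.union houter_meas) hfE hfout).1
    have hμ := (measureReal_le_integral_le_measureReal μ hL.continuous h0 h1
      hEm (hEm.union houter_meas) hfE hfout).2
    have hunion : μ.real (E ∪ outer) ≤ μ.real E + μ.real outer := measureReal_union_le _ _
    linarith [(abs_le.1 (herr f h0 h1 hL)).2]
  have hlower : μ.real E - μ.real inner - 2 * r ≤ (μT T).real E := by
    let f : X → ℝ := fun x => min (Metric.infDist x Eᶜ / r) 1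
    have h0 : ∀ x, 0 ≤ f x := fun x =>
      le_min (div_nonneg Metric.infDist_nonneg hr0.le) zero_le_one
    have h1 : ∀ x, f x ≤ 1 := fun x => min_le_right _ _
    have hL : LipschitzWith (Real.toNNReal r⁻¹) f := (lipschitzWith_infDist_div Eᶜ hr0).min_const 1
    have hfinner : ∀ x ∈ E \ inner, 1 ≤ f x := fun x hx => by
      have hxr : r ≤ Metric.infDist x Eᶜ := not_lt.1 fun h => hx.2 ⟨hx.1, h⟩
      exact le_min ((one_le_div hr0).2 hxr) le_rfl
    have hfE : ∀ x ∉ E, f x ≤ 0 := fun x hx => by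
      simp [f, Metric.infDist_zero_of_mem (Set.mem_compl hx)]
    have hT' := (measureReal_le_integral_le_measureReal (μT T) hL.continuous h0 h1
      (hEm.diff hinner_meas) hEm hfinner hfE).2
    have hμ := (measureReal_le_integral_le_measureReal μ hL.continuous h0 h1
      (hEm.diff hinner_meas) hEm hfinner hfE).1
    have hdiff : μ.real E - μ.real inner ≤ μ.real (E \ inner) := le_measureReal_sdiff
    linarith [(abs_le.1 (herr f h0 h1 hL)).1]
  rw [abs_le]
  constructor <;> linarith
end
end

section
/- (Siegel's integral formula.) Let n ≥ 2 be an integer and let μ be an SL_n(ℝ)-invariant Borel probability measure on X = SL_n(ℝ)/SL_n(ℤ). For every measurable, bounded, compactly supported function f : ℝ^n → ℝ, let f̂ : X → ℝ be the well-defined function satisfying f̂(⟦g⟧) = Σ_{v ∈ ℤ^n, v ≠ 0} f(g·v) for every g ∈ SL_n(ℝ). Then ∫_X f̂ dμ = ∫_{ℝ^n} f(x) dx, where dx is Lebesgue measure on ℝ^n. -/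
noncomputable section

open MeasureTheory Matrix Pointwise

namespace SiegelFormula

open Filter Topology Set
open scoped ENNReal

/-- The image in `ℝ^n` of an integer vector. -/
abbrev intVec {n : ℕ} (v : Fin n → ℤ) : Fin n → ℝ := fun i => (v i : ℝ)

section Topology

variable {n : ℕ}

instance : IsTopologicalGroup (SLR n) := Matrix.SpecialLinearGroup.topologicalGroup

theorem continuous_coe : Continuous fun g : SLR n => (g : Matrix (Fin n) (Fin n) ℝ) :=
  continuous_induced_dom

instance : PolishSpace (SLR n) := by
  have : PolishSpace (Matrix (Fin n) (Fin n) ℝ) :=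
    inferInstanceAs (PolishSpace (Fin n → Fin n → ℝ))
  exact (Matrix.SpecialLinearGroup.isClosedEmbedding_val (n := Fin n) (R := ℝ)).polishSpace

theorem isClosed_SLZsub : IsClosed (SLZsub n : Set (SLR n)) := by
  have h := (Topology.IsClosedEmbedding.specialLinearGroup_map (n := Fin n)
    (f := Int.castRingHom ℝ) Int.isClosedEmbedding_coe_real).isClosed_range
  rw [SLZsub, MonoidHom.coe_range]
  exact h

instance : T1Space (XQuot n) := by
  have : IsClosed (SLZsub n : Set (SLR n)) := isClosed_SLZsub
  infer_instance

instance : BorelSpace (XQuot n) := ⟨rfl⟩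

instance : SecondCountableTopology (XQuot n) := inferInstance

/-- A function on the space of lattices is measurable as soon as its lift is continuous or Borel. -/
theorem measurable_of_comp_mk {β : Type*} [MeasurableSpace β] {F : XQuot n → β}
    (h : @Measurable _ _ (borel (SLR n)) _ fun g => F (QuotientGroup.mk g)) : Measurable F := by
  have e := Continuous.map_borel_eq (X := SLR n) (Y := XQuot n) (f := QuotientGroup.mk)
    QuotientGroup.continuous_mk QuotientGroup.mk_surjective
  intro s hs
  change MeasurableSet[borel (XQuot n)] _
  rw [← e]
  exact h hs

end Topology

section Lattice

variable {n : ℕ}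

/-- The Siegel transform `∑_{v ≠ 0} f (g v)`, as an extended nonnegative number. -/
def latSum (f : (Fin n → ℝ) → ℝ≥0∞) (g : SLR n) : ℝ≥0∞ :=
  ∑' v : {v : Fin n → ℤ // v ≠ 0},
    f ((g : Matrix (Fin n) (Fin n) ℝ).mulVec (intVec v))

theorem latSum_mul_right (f : (Fin n → ℝ) → ℝ≥0∞) (g γ : SLR n) (hγ : γ ∈ SLZsub n) :
    latSum f (g * γ) = latSum f g := by
  obtain ⟨A, rfl⟩ := hγ
  let e : {v : Fin n → ℤ // v ≠ 0} ≃ {v : Fin n → ℤ // v ≠ 0} :=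
    (Matrix.SpecialLinearGroup.toLin' A).toEquiv.subtypeEquiv fun v => by
      simp
  refine Eq.trans ?_ (e.tsum_eq fun v => f ((g : Matrix (Fin n) (Fin n) ℝ).mulVec (intVec v)))
  refine tsum_congr fun v => ?_
  congr 1
  rw [Matrix.SpecialLinearGroup.coe_mul, ← Matrix.mulVec_mulVec]
  congr 1
  ext i
  simp [e, intVec, Matrix.mulVec, dotProduct, Matrix.SpecialLinearGroup.toLin'_apply]

/-- The point measure on the nonzero vectors of a lattice. -/
def pointMeasure (x : XQuot n) : Measure (Fin n → ℝ) :=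
  Measure.sum fun v : {v : Fin n → ℤ // v ≠ 0} =>
    Measure.dirac (((Quotient.out x : SLR n) : Matrix (Fin n) (Fin n) ℝ).mulVec (intVec v))

theorem lintegral_pointMeasure {f : (Fin n → ℝ) → ℝ≥0∞} (hf : Measurable f) (g : SLR n) :
    ∫⁻ y, f y ∂(pointMeasure (QuotientGroup.mk g : XQuot n)) = latSum f g := by
  have hout : (QuotientGroup.mk (Quotient.out (QuotientGroup.mk g : XQuot n)) : XQuot n) =
      QuotientGroup.mk g := Quotient.out_eq' _
  have hmem := QuotientGroup.eq.1 hout.symm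
  have := latSum_mul_right f g _ hmem
  rw [mul_inv_cancel_left] at this
  rw [← this, pointMeasure, lintegral_sum_measure, latSum]
  simp_rw [lintegral_dirac' _ hf]

theorem measurable_lintegral_pointMeasure {f : (Fin n → ℝ) → ℝ≥0∞} (hf : Measurable f) :
    Measurable fun x : XQuot n => ∫⁻ y, f y ∂(pointMeasure x) := by
  apply measurable_of_comp_mk
  simp_rw [lintegral_pointMeasure hf]
  borelize (SLR n)
  refine Measurable.tsum fun v => hf.comp ?_
  exact (continuous_coe.matrix_mulVec continuous_const).measurable

theorem measurable_pointMeasure : Measurable (pointMeasure (n := n)) := by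
  refine Measure.measurable_of_measurable_coe _ fun s hs => ?_
  simpa [lintegral_indicator_one hs] using
    measurable_lintegral_pointMeasure (n := n) (f := s.indicator 1) (measurable_one.indicator hs)

/-- The intensity measure of the random point set `L \ {0}`, where `L` has law `μ`. -/
def intensity (μ : Measure (XQuot n)) : Measure (Fin n → ℝ) := μ.bind pointMeasure

theorem lintegral_intensity (μ : Measure (XQuot n)) {f : (Fin n → ℝ) → ℝ≥0∞}
    (hf : Measurable f) :
    ∫⁻ y, f y ∂(intensity μ) = ∫⁻ x, ∫⁻ y, f y ∂(pointMeasure x) ∂μ :=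
  Measure.lintegral_bind measurable_pointMeasure.aemeasurable hf.aemeasurable

theorem lintegral_pointMeasure_smul {f : (Fin n → ℝ) → ℝ≥0∞} (hf : Measurable f)
    (g : SLR n) (x : XQuot n) :
    ∫⁻ y, f y ∂(pointMeasure (g • x)) =
      ∫⁻ y, f ((g : Matrix (Fin n) (Fin n) ℝ).mulVec y) ∂(pointMeasure x) := by
  obtain ⟨h, rfl⟩ := QuotientGroup.mk_surjective x
  have hf' : Measurable fun y => f ((g : Matrix (Fin n) (Fin n) ℝ).mulVec y) :=
    hf.comp (Continuous.matrix_mulVec continuous_const continuous_id).measurable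
  have e : g • (QuotientGroup.mk h : XQuot n) = QuotientGroup.mk (g * h) := rfl
  rw [e, lintegral_pointMeasure hf, lintegral_pointMeasure hf', latSum, latSum]
  simp [Matrix.mulVec_mulVec]

theorem measurable_smul_XQuot (g : SLR n) : Measurable fun x : XQuot n => g • x :=
  (continuous_const_smul g).measurable

theorem map_mulVec_intensity {μ : Measure (XQuot n)}
    (hinv : ∀ g : SLR n, Measure.map (fun x => g • x) μ = μ) (g : SLR n) :
    (intensity μ).map (fun y => (g : Matrix (Fin n) (Fin n) ℝ).mulVec y) = intensity μ := by
  have hm : Measurable fun y => (g : Matrix (Fin n) (Fin n) ℝ).mulVec y :=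
    (Continuous.matrix_mulVec continuous_const continuous_id).measurable
  refine Measure.ext_of_lintegral _ fun f hf => ?_
  rw [lintegral_map hf hm,
    lintegral_intensity μ (f := fun y => f ((g : Matrix (Fin n) (Fin n) ℝ).mulVec y)) (hf.comp hm), lintegral_intensity μ hf]
  conv_rhs => rw [← hinv g, lintegral_map (measurable_lintegral_pointMeasure hf)
    (measurable_smul_XQuot g)]
  simp_rw [lintegral_pointMeasure_smul hf]

theorem map_mulVec_volume (g : SLR n) :
    (volume : Measure (Fin n → ℝ)).map
      (fun y => (g : Matrix (Fin n) (Fin n) ℝ).mulVec y) = volume := by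
  have := Real.map_matrix_volume_pi_eq_smul_volume_pi
    (M := (g : Matrix (Fin n) (Fin n) ℝ)) (by simp)
  rw [Matrix.SpecialLinearGroup.det_coe, inv_one, abs_one, ENNReal.ofReal_one, one_smul] at this
  exact this

end Lattice

section Averaging

/-- If the averages of a nonnegative function `W` along probability measures on a family of
measure-preserving maps converge pointwise to a constant, then that constant is the integral
of `W`. No integrability of `W` is assumed. -/
theorem lintegral_eq_of_tendsto_average {X Θ : Type*} [MeasurableSpace X] [MeasurableSpace Θ]
    {μ : Measure X} [IsProbabilityMeasure μ] {σ : Measure Θ} [IsProbabilityMeasure σ]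
    {W : X → ℝ≥0∞} (hW : Measurable W) {a : ℕ → Θ → X → X}
    (ha : ∀ k, Measurable (Function.uncurry (a k)))
    (hinv : ∀ k θ, μ.map (a k θ) = μ) {c : ℝ≥0∞}
    (hlim : ∀ x, Tendsto (fun k => ∫⁻ θ, W (a k θ x) ∂σ) atTop (𝓝 c)) :
    ∫⁻ x, W x ∂μ = c := by
  have hmp : ∀ k θ, Measurable (a k θ) := fun k θ => (ha k).comp measurable_prodMk_left
  have hswap : ∀ V : X → ℝ≥0∞, Measurable V → ∀ k,
      ∫⁻ x, ∫⁻ θ, V (a k θ x) ∂σ ∂μ = ∫⁻ x, V x ∂μ := by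
    intro V hV k
    rw [lintegral_lintegral_swap (f := fun x θ => V (a k θ x))
      (hV.comp ((ha k).comp measurable_swap)).aemeasurable]
    have : ∀ θ, ∫⁻ x, V (a k θ x) ∂μ = ∫⁻ x, V x ∂μ := fun θ => by
      rw [← lintegral_map hV (hmp k θ), hinv]
    simp [this]
  have hmeas : ∀ k, Measurable fun x => ∫⁻ θ, W (a k θ x) ∂σ := fun k =>
    Measurable.lintegral_prod_left (hW.comp (ha k))
  apply le_antisymm
  · have hM : ∀ M : ℕ, ∫⁻ x, min (W x) M ∂μ ≤ c := by
      intro M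
      have hlimM : Tendsto (fun k => ∫⁻ x, min (∫⁻ θ, W (a k θ x) ∂σ) M ∂μ) atTop
          (𝓝 (∫⁻ _, min c M ∂μ)) := by
        refine tendsto_lintegral_of_dominated_convergence (fun _ => (M : ℝ≥0∞))
          (fun k => (hmeas k).min measurable_const)
          (fun k => Eventually.of_forall fun x => min_le_right _ _) (by simp) ?_
        exact Eventually.of_forall fun x => (hlim x).min tendsto_const_nhds
      rw [lintegral_const, measure_univ, mul_one] at hlimM
      refine (ge_of_tendsto' hlimM fun k => ?_).trans (min_le_left _ _)
      rw [← hswap (fun x => min (W x) M) (hW.min measurable_const) k]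
      refine lintegral_mono fun x => le_min (lintegral_mono fun θ => min_le_left _ _) ?_
      exact (lintegral_mono fun θ => min_le_right _ _).trans (by simp)
    have hsup : ∀ x, W x = ⨆ M : ℕ, min (W x) M := fun x => by
      rw [← inf_iSup_eq, ENNReal.iSup_natCast, inf_top_eq]
    calc ∫⁻ x, W x ∂μ = ∫⁻ x, ⨆ M : ℕ, min (W x) M ∂μ := by simp_rw [← hsup]
      _ = ⨆ M : ℕ, ∫⁻ x, min (W x) M ∂μ :=
        lintegral_iSup (fun M => hW.min measurable_const) fun M N hMN x =>
          min_le_min_left _ (by exact_mod_cast hMN)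
      _ ≤ c := iSup_le hM
  · calc c = ∫⁻ _, c ∂μ := by simp
      _ = ∫⁻ x, liminf (fun k => ∫⁻ θ, W (a k θ x) ∂σ) atTop ∂μ := by
        simp_rw [(hlim _).liminf_eq]
      _ ≤ liminf (fun k => ∫⁻ x, ∫⁻ θ, W (a k θ x) ∂σ ∂μ) atTop := lintegral_liminf_le hmeas
      _ = ∫⁻ x, W x ∂μ := by simp [hswap W hW]

end Averaging

section Extensionality

variable {E : Type*} [MetricSpace E] [ProperSpace E] [MeasurableSpace E] [BorelSpace E]

theorem measure_le_of_lintegral_eq {μ ν : Measure E} {U : Set E} (hU : IsOpen U)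
    (h : ∀ f : E → ℝ, Continuous f → HasCompactSupport f → (∀ x, 0 ≤ f x) → tsupport f ⊆ U →
      ∫⁻ x, ENNReal.ofReal (f x) ∂μ = ∫⁻ x, ENNReal.ofReal (f x) ∂ν) : μ U ≤ ν U := by
  rcases isEmpty_or_nonempty E with hE | ⟨⟨p⟩⟩
  · simp [Set.eq_empty_of_isEmpty U]
  obtain ⟨F, hFc, hFU, hF, hmono⟩ := hU.exists_iUnion_isClosed
  have hUeq : U = ⋃ k : ℕ, F k ∩ Metric.closedBall p k := by
    rw [Set.iUnion_inter_of_monotone hmono (t := fun k : ℕ => Metric.closedBall p k)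
      (fun a b hab => Metric.closedBall_subset_closedBall (by exact_mod_cast hab)),
      hF, Metric.iUnion_closedBall_nat, Set.inter_univ]
  have hm : Monotone fun k : ℕ => F k ∩ Metric.closedBall p k := fun a b hab =>
    Set.inter_subset_inter (hmono hab)
      (Metric.closedBall_subset_closedBall (by exact_mod_cast hab))
  conv_lhs => rw [hUeq]
  rw [hm.measure_iUnion]
  refine iSup_le fun k => ?_
  have hK : IsCompact (F k ∩ Metric.closedBall p k) :=
    (isCompact_closedBall p k).inter_left (hFc k)
  obtain ⟨f, hf1, hfc, hfU, hf01⟩ := exists_continuousMap_one_of_isCompact_subset_isOpen hK hU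
    (Set.inter_subset_left.trans (hFU k))
  calc μ (F k ∩ Metric.closedBall p k)
      = ∫⁻ x, (F k ∩ Metric.closedBall p k).indicator 1 x ∂μ :=
        (lintegral_indicator_one hK.measurableSet).symm
    _ ≤ ∫⁻ x, ENNReal.ofReal (f x) ∂μ := lintegral_mono fun x => by
        by_cases hx : x ∈ F k ∩ Metric.closedBall p k
        · simp [Set.indicator_of_mem hx, hf1 hx]
        · simp [Set.indicator_of_notMem hx]
    _ = ∫⁻ x, ENNReal.ofReal (f x) ∂ν := h f f.continuous hfc (fun x => (hf01 x).1) hfU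
    _ ≤ ∫⁻ x, U.indicator 1 x ∂ν := lintegral_mono fun x => by
        by_cases hx : x ∈ U
        · simpa [Set.indicator_of_mem hx] using (hf01 x).2
        · simp [image_eq_zero_of_notMem_tsupport fun h' => hx (hfU h')]
    _ = ν U := lintegral_indicator_one hU.measurableSet

theorem restrict_eq_of_lintegral_eq {μ ν : Measure E} [IsFiniteMeasureOnCompacts ν]
    {H : Set E} (hH : IsOpen H)
    (h : ∀ f : E → ℝ, Continuous f → HasCompactSupport f → (∀ x, 0 ≤ f x) → tsupport f ⊆ H →
      ∫⁻ x, ENNReal.ofReal (f x) ∂μ = ∫⁻ x, ENNReal.ofReal (f x) ∂ν) :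
    μ.restrict H = ν.restrict H := by
  rcases isEmpty_or_nonempty E with hE | ⟨⟨p⟩⟩
  · exact Measure.ext fun s _ => by simp [Set.eq_empty_of_isEmpty s]
  have key : ∀ U, IsOpen U → μ.restrict H U = ν.restrict H U := by
    intro U hU
    rw [Measure.restrict_apply hU.measurableSet, Measure.restrict_apply hU.measurableSet]
    have hU' := hU.inter hH
    exact le_antisymm
      (measure_le_of_lintegral_eq hU' fun f h1 h2 h3 h4 =>
        h f h1 h2 h3 (h4.trans Set.inter_subset_right))
      (measure_le_of_lintegral_eq hU' fun f h1 h2 h3 h4 =>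
        (h f h1 h2 h3 (h4.trans Set.inter_subset_right)).symm)
  refine Measure.ext_of_generateFrom_of_iUnion {s | IsOpen s} (fun k : ℕ => Metric.ball p k)
    (BorelSpace.measurable_eq (α := E)) isPiSystem_isOpen (Metric.iUnion_ball_nat p)
    (fun k => Metric.isOpen_ball) (fun k => ?_) key
  rw [key _ Metric.isOpen_ball]
  exact ((Measure.restrict_apply_le _ _).trans_lt measure_ball_lt_top).ne

end Extensionality

section RiemannSum

variable {n : ℕ}

theorem norm_le_mul_norm_mulVec (g : SLR n) :
    ∃ K : ℝ, 0 < K ∧ ∀ y : Fin n → ℝ,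
      ‖y‖ ≤ K * ‖(g : Matrix (Fin n) (Fin n) ℝ).mulVec y‖ := by
  let L : (Fin n → ℝ) →L[ℝ] (Fin n → ℝ) :=
    (Matrix.toLin' ((g⁻¹ : SLR n) : Matrix (Fin n) (Fin n) ℝ)).toContinuousLinearMap
  refine ⟨‖L‖ + 1, by positivity, fun y => ?_⟩
  have h : L ((g : Matrix (Fin n) (Fin n) ℝ).mulVec y) = y := by
    change ((g⁻¹ : SLR n) : Matrix (Fin n) (Fin n) ℝ).mulVec _ = _
    rw [Matrix.mulVec_mulVec, ← Matrix.SpecialLinearGroup.coe_mul, inv_mul_cancel,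
      Matrix.SpecialLinearGroup.coe_one, Matrix.one_mulVec]
  calc ‖y‖ = ‖L ((g : Matrix (Fin n) (Fin n) ℝ).mulVec y)‖ := by rw [h]
    _ ≤ ‖L‖ * ‖(g : Matrix (Fin n) (Fin n) ℝ).mulVec y‖ := L.le_opNorm _
    _ ≤ _ := by gcongr; linarith

theorem finite_norm_mulVec_intVec_le (g : SLR n) (r : ℝ) :
    {v : Fin n → ℤ | ‖(g : Matrix (Fin n) (Fin n) ℝ).mulVec (intVec v)‖ ≤ r}.Finite := by
  obtain ⟨K, hK, h⟩ := norm_le_mul_norm_mulVec g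
  refine (Set.finite_Icc (fun _ : Fin n => -⌈K * r⌉) (fun _ => ⌈K * r⌉)).subset fun v hv => ?_
  have hv' : ‖intVec v‖ ≤ K * r := (h _).trans (by gcongr; exact hv)
  have hi : ∀ i, |(v i : ℝ)| ≤ ⌈K * r⌉ := fun i =>
    (norm_le_pi_norm (intVec v) i).trans (hv'.trans (Int.le_ceil _))
  refine ⟨fun i => ?_, fun i => ?_⟩
  · exact_mod_cast (abs_le.1 (hi i)).1
  · exact_mod_cast (abs_le.1 (hi i)).2

/-- A function of bounded support sums over finitely many points of a rescaled lattice. -/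
theorem finite_support_lattice (g : SLR n) {F : (Fin n → ℝ) → ℝ} {C : ℝ}
    (hF : ∀ x, F x ≠ 0 → ‖x‖ ≤ C) {T : ℝ} (hT : 0 < T) :
    (Function.support fun v : Fin n → ℤ =>
      F (T⁻¹ • (g : Matrix (Fin n) (Fin n) ℝ).mulVec (intVec v))).Finite := by
  refine (finite_norm_mulVec_intVec_le g (T * C)).subset fun v hv => ?_
  have := hF _ hv
  rw [norm_smul, norm_inv, Real.norm_of_nonneg hT.le, inv_mul_le_iff₀ hT] at this
  exact this

theorem tendsto_tsum_lattice (g : SLR n) {F : (Fin n → ℝ) → ℝ} (hFc : Continuous F) {C : ℝ}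
    (hF : ∀ x, F x ≠ 0 → ‖x‖ ≤ C) :
    Tendsto (fun T : ℕ => (∑' v : Fin n → ℤ,
        F ((T : ℝ)⁻¹ • (g : Matrix (Fin n) (Fin n) ℝ).mulVec (intVec v))) / (T : ℝ) ^ n)
      atTop (𝓝 (∫ x, F x)) := by
  obtain ⟨K, hK, h⟩ := norm_le_mul_norm_mulVec g
  set G : (Fin n → ℝ) → ℝ := fun y => F ((g : Matrix (Fin n) (Fin n) ℝ).mulVec y) with hG
  have hcont : Continuous fun y => (g : Matrix (Fin n) (Fin n) ℝ).mulVec y :=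
    Continuous.matrix_mulVec continuous_const continuous_id
  have hGc : Continuous G := hFc.comp hcont
  set s : Set (Fin n → ℝ) := Metric.closedBall 0 (K * C)
  have hGs : ∀ y, G y ≠ 0 → y ∈ s := fun y hy => by
    rw [mem_closedBall_zero_iff]
    exact (h y).trans (by gcongr; exact hF _ hy)
  have hint : ∫ x in s, G x = ∫ x, F x := by
    rw [setIntegral_eq_integral_of_forall_compl_eq_zero fun y hy => not_not.1 fun h' =>
      hy (hGs y h')]
    conv_rhs => rw [← map_mulVec_volume g]
    rw [integral_map hcont.aemeasurable hFc.aestronglyMeasurable]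
  have hfr : volume (frontier s) = 0 := (convex_closedBall _ _).addHaar_frontier _
  have hmain := tendsto_tsum_div_pow_atTop_integral s G hGc Metric.isBounded_closedBall
    Metric.isClosed_closedBall.measurableSet hfr
  rw [hint, Fintype.card_fin] at hmain
  refine hmain.congr' ?_
  filter_upwards [eventually_gt_atTop 0] with T hT
  have hT0 : (T : ℝ) ≠ 0 := by positivity
  congr 1
  set A : Set (Fin n → ℝ) := s ∩ (T : ℝ)⁻¹ •
    (Submodule.span ℤ (Set.range (Pi.basisFun ℝ (Fin n))) : Set (Fin n → ℝ))
  have hmem : ∀ v : Fin n → ℤ, (intVec v : Fin n → ℝ) ∈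
      (Submodule.span ℤ (Set.range (Pi.basisFun ℝ (Fin n))) : Set (Fin n → ℝ)) := fun v => by
    rw [SetLike.mem_coe, Module.Basis.mem_span_iff_repr_mem]
    intro i
    exact ⟨v i, by simp [intVec]⟩
  have hinj : Function.Injective fun v : Fin n → ℤ => (T : ℝ)⁻¹ • intVec v := by
    intro v w hvw
    have := smul_right_injective (Fin n → ℝ) (inv_ne_zero hT0) hvw
    ext i
    exact_mod_cast congrFun this i
  have hsub : Function.support (A.indicator G) ⊆
      Set.range fun v : Fin n → ℤ => (T : ℝ)⁻¹ • intVec v := by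
    intro x hx
    obtain ⟨-, z, hz, rfl⟩ := Set.mem_of_indicator_ne_zero hx
    rw [SetLike.mem_coe, Module.Basis.mem_span_iff_repr_mem] at hz
    choose v hv using hz
    refine ⟨v, ?_⟩
    simp only
    congr 1
    ext i
    simpa using hv i
  rw [tsum_subtype A G, ← hinj.tsum_eq hsub]
  refine tsum_congr fun v => ?_
  have hval : G ((T : ℝ)⁻¹ • intVec v) =
      F ((T : ℝ)⁻¹ • (g : Matrix (Fin n) (Fin n) ℝ).mulVec (intVec v)) := by
    simp only [hG]
    rw [Matrix.mulVec_smul]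
  rw [← hval]
  by_cases h0 : G ((T : ℝ)⁻¹ • intVec v) = 0
  · rw [h0]
    exact Set.indicator_apply_eq_zero.2 fun _ => h0
  · have hA : (T : ℝ)⁻¹ • intVec v ∈ A := ⟨hGs _ h0, Set.smul_mem_smul_set (hmem v)⟩
    exact Set.indicator_of_mem hA _

/-- Riemann sums over rescaled lattices of functions `Φ T` converging uniformly, with uniformly
bounded supports, to a continuous function. -/
theorem tendsto_tsum_lattice_of_uniform (g : SLR n) {F : (Fin n → ℝ) → ℝ} (hFc : Continuous F)
    {Φ : ℕ → (Fin n → ℝ) → ℝ} {C : ℝ} (hF : ∀ x, F x ≠ 0 → ‖x‖ ≤ C)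
    (hΦ : ∀ T x, 0 < T → Φ T x ≠ 0 → ‖x‖ ≤ C)
    (hlim : ∀ ε > 0, ∀ᶠ T : ℕ in atTop, ∀ x, |Φ T x - F x| ≤ ε) :
    Tendsto (fun T : ℕ => (∑' v : Fin n → ℤ,
        Φ T ((T : ℝ)⁻¹ • (g : Matrix (Fin n) (Fin n) ℝ).mulVec (intVec v))) / (T : ℝ) ^ n)
      atTop (𝓝 (∫ x, F x)) := by
  set χ : (Fin n → ℝ) → ℝ := fun x => max 0 (min 1 (C + 1 - ‖x‖)) with hχdef
  have hχc : Continuous χ := by fun_prop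
  have hχ0 : ∀ x, χ x ≠ 0 → ‖x‖ ≤ C + 1 := by
    intro x hx
    by_contra! hlt
    apply hx
    have : min 1 (C + 1 - ‖x‖) ≤ 0 := (min_le_right _ _).trans (by linarith)
    simp [hχdef, this]
  have hχ1 : ∀ x, ‖x‖ ≤ C → χ x = 1 := by
    intro x hx
    have : min 1 (C + 1 - ‖x‖) = 1 := min_eq_left (by linarith)
    simp [hχdef, this]
  have hχnn : ∀ x, 0 ≤ χ x := fun x => le_max_left _ _
  have h1 := tendsto_tsum_lattice g hFc hF
  have h2 := tendsto_tsum_lattice g hχc hχ0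
  set I := ∫ x, χ x
  have hI : 0 ≤ I := integral_nonneg hχnn
  rw [Metric.tendsto_atTop'] at h1 ⊢
  intro ε hε
  obtain ⟨N1, hN1⟩ := h1 (ε / 2) (by positivity)
  have h3 : ∀ᶠ T : ℕ in atTop, (∑' v : Fin n → ℤ,
      χ ((T : ℝ)⁻¹ • (g : Matrix (Fin n) (Fin n) ℝ).mulVec (intVec v))) / (T : ℝ) ^ n < I + 1 :=
    h2.eventually_lt_const (by linarith)
  have hδ : 0 < ε / (2 * (I + 1)) := by positivity
  obtain ⟨N, hN⟩ := eventually_atTop.1 ((h3.and (hlim _ hδ)).and (eventually_gt_atTop (max 0 N1)))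
  refine ⟨N, fun T hT => ?_⟩
  obtain ⟨⟨hT1, hT2⟩, hT3⟩ := hN T hT.le
  have hT0 : 0 < T := (le_max_left _ _).trans_lt hT3
  have hTr : (0 : ℝ) < T := by exact_mod_cast hT0
  have hsF := summable_of_hasFiniteSupport (L := .unconditional _)
    (finite_support_lattice g hF hTr)
  have hsΦ := summable_of_hasFiniteSupport (L := .unconditional _)
    (finite_support_lattice g (fun x => hΦ T x hT0) hTr)
  have hsχ := summable_of_hasFiniteSupport (L := .unconditional _)
    (finite_support_lattice g hχ0 hTr)
  have hpt : ∀ x, |Φ T x - F x| ≤ ε / (2 * (I + 1)) * χ x := by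
    intro x
    by_cases hx : ‖x‖ ≤ C
    · rw [hχ1 x hx, mul_one]
      exact hT2 x
    · rw [not_not.1 fun h => hx (hΦ T x hT0 h), not_not.1 fun h => hx (hF x h), sub_zero, abs_zero]
      exact mul_nonneg hδ.le (hχnn x)
  have hdist : |(∑' v : Fin n → ℤ,
        Φ T ((T : ℝ)⁻¹ • (g : Matrix (Fin n) (Fin n) ℝ).mulVec (intVec v))) / (T : ℝ) ^ n -
      (∑' v : Fin n → ℤ,
        F ((T : ℝ)⁻¹ • (g : Matrix (Fin n) (Fin n) ℝ).mulVec (intVec v))) / (T : ℝ) ^ n| ≤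
      ε / (2 * (I + 1)) * ((∑' v : Fin n → ℤ,
        χ ((T : ℝ)⁻¹ • (g : Matrix (Fin n) (Fin n) ℝ).mulVec (intVec v))) / (T : ℝ) ^ n) := by
    rw [← sub_div, abs_div, abs_of_pos (pow_pos hTr n), ← mul_div_assoc, ← hsΦ.tsum_sub hsF,
      ← tsum_mul_left]
    gcongr
    have hs := (hsχ.mul_left (ε / (2 * (I + 1))))
    rw [← Real.norm_eq_abs]
    exact tsum_of_norm_bounded hs.hasSum fun v => hpt _
  have hlt : ε / (2 * (I + 1)) * ((∑' v : Fin n → ℤ,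
        χ ((T : ℝ)⁻¹ • (g : Matrix (Fin n) (Fin n) ℝ).mulVec (intVec v))) / (T : ℝ) ^ n) < ε / 2 :=
    calc _ < ε / (2 * (I + 1)) * (I + 1) := by gcongr
      _ = ε / 2 := by field_simp
  have h4 := hN1 T ((le_max_right _ _).trans_lt hT3)
  rw [Real.dist_eq] at h4 ⊢
  calc _ ≤ _ := abs_sub_le _ _ _
    _ < ε / 2 + ε / 2 := add_lt_add (hdist.trans_lt hlt) h4
    _ = ε := by ring

end RiemannSum

section Kernel

variable {m : ℕ}

theorem integral_eq_integral_cons {F : (Fin (m + 1) → ℝ) → ℝ} (hF : Integrable F) :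
    ∫ x, F x = ∫ t : ℝ, ∫ y : Fin m → ℝ, F (Fin.cons t y) := by
  have h := (volume_preserving_piFinSuccAbove (fun _ : Fin (m + 1) => ℝ) 0).symm
  have he : ∀ p, (MeasurableEquiv.piFinSuccAbove (fun _ : Fin (m + 1) => ℝ) 0).symm p =
      Fin.cons p.1 p.2 := fun p => by
    simp [MeasurableEquiv.piFinSuccAbove_symm_apply, Fin.insertNthEquiv]
  rw [← h.integral_comp', Measure.volume_eq_prod, integral_prod]
  · simp_rw [he]
  · exact (h.integrable_comp_emb (MeasurableEquiv.measurableEmbedding _)).2 hF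

theorem norm_cons_le_iff {t : ℝ} {y : Fin m → ℝ} {C : ℝ} (hC : 0 ≤ C) :
    ‖(Fin.cons t y : Fin (m + 1) → ℝ)‖ ≤ C ↔ |t| ≤ C ∧ ‖y‖ ≤ C := by
  rw [pi_norm_le_iff_of_nonneg hC, Fin.forall_fin_succ, pi_norm_le_iff_of_nonneg hC]
  simp

theorem continuous_cons : Continuous fun p : ℝ × (Fin m → ℝ) =>
    (Fin.cons p.1 p.2 : Fin (m + 1) → ℝ) :=
  continuous_fst.finCons (A := fun _ => ℝ) continuous_snd

/-- The average of `f` over an expanding piece of a horosphere, at scale `s`. -/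
def avgDensity (ρ : (Fin m → ℝ) → ℝ) (f : (Fin (m + 1) → ℝ) → ℝ) (s : ℝ)
    (z : Fin (m + 1) → ℝ) : ℝ :=
  s ^ m * ∫ θ, ρ θ * f (Fin.cons (z 0) (s • (z 0 • θ + Fin.tail z)))

/-- The pointwise limit of `avgDensity` as the scale goes to infinity. -/
def limDensity (ρ : (Fin m → ℝ) → ℝ) (f : (Fin (m + 1) → ℝ) → ℝ) (z : Fin (m + 1) → ℝ) : ℝ :=
  (|z 0| ^ m)⁻¹ * (ρ (-((z 0)⁻¹ • Fin.tail z)) * ∫ y, f (Fin.cons (z 0) y))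

theorem avgDensity_eq (ρ : (Fin m → ℝ) → ℝ) (f : (Fin (m + 1) → ℝ) → ℝ) {s : ℝ} (hs : 0 < s)
    {z : Fin (m + 1) → ℝ} (hz : z 0 ≠ 0) :
    avgDensity ρ f s z = (|z 0| ^ m)⁻¹ *
      ∫ y, ρ ((z 0)⁻¹ • (s⁻¹ • y - Fin.tail z)) * f (Fin.cons (z 0) y) := by
  set k : (Fin m → ℝ) → ℝ := fun y =>
    ρ ((z 0)⁻¹ • (s⁻¹ • y - Fin.tail z)) * f (Fin.cons (z 0) y) with hk
  have h1 : ∀ θ : Fin m → ℝ, ρ θ * f (Fin.cons (z 0) (s • (z 0 • θ + Fin.tail z))) =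
      k ((s * z 0) • θ + s • Fin.tail z) := by
    intro θ
    have e : (s * z 0) • θ + s • Fin.tail z = s • (z 0 • θ + Fin.tail z) := by
      rw [smul_add, smul_smul]
    rw [hk, e]
    simp only
    rw [inv_smul_smul₀ hs.ne', add_sub_cancel_right, inv_smul_smul₀ hz]
  rw [avgDensity]
  simp_rw [h1]
  rw [Measure.integral_comp_smul volume (fun y => k (y + s • Fin.tail z)),
    integral_add_right_eq_self, Module.finrank_fin_fun, smul_eq_mul, abs_inv, abs_pow, abs_mul,
    abs_of_pos hs, mul_pow]
  field_simp

variable {ρ : (Fin m → ℝ) → ℝ} {f : (Fin (m + 1) → ℝ) → ℝ} {a R : ℝ}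

theorem norm_le_of_limDensity_ne_zero (hρ : ∀ θ, ρ θ ≠ 0 → ‖θ‖ ≤ 1)
    (ha : 0 < a) (hfa : ∀ x, f x ≠ 0 → a ≤ |x 0|) (hR : 0 ≤ R) (hfR : ∀ x, f x ≠ 0 → ‖x‖ ≤ R)
    {z : Fin (m + 1) → ℝ} (hz : limDensity ρ f z ≠ 0) : ‖z‖ ≤ 2 * R := by
  have h1 := right_ne_zero_of_mul hz
  have h2 := hρ _ (left_ne_zero_of_mul h1)
  obtain ⟨y, hy⟩ : ∃ y : Fin m → ℝ, f (Fin.cons (z 0) y) ≠ 0 := by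
    by_contra! h
    exact right_ne_zero_of_mul h1 (by simp [h])
  have h3 := ((norm_cons_le_iff hR).1 (hfR _ hy)).1
  have h4 : 0 < |z 0| := by simpa using ha.trans_le (hfa _ hy)
  rw [norm_neg, norm_smul, norm_inv, Real.norm_eq_abs, inv_mul_le_iff₀ h4, mul_one] at h2
  rw [← Fin.cons_self_tail z, norm_cons_le_iff (by positivity)]
  constructor <;> linarith

theorem norm_le_of_avgDensity_ne_zero (hρ : ∀ θ, ρ θ ≠ 0 → ‖θ‖ ≤ 1) (hR : 0 ≤ R) (hfR : ∀ x, f x ≠ 0 → ‖x‖ ≤ R)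
    {s : ℝ} (hs : 1 ≤ s) {z : Fin (m + 1) → ℝ} (hz : avgDensity ρ f s z ≠ 0) : ‖z‖ ≤ 2 * R := by
  obtain ⟨θ, hθ⟩ : ∃ θ, ρ θ * f (Fin.cons (z 0) (s • (z 0 • θ + Fin.tail z))) ≠ 0 := by
    by_contra! h
    exact hz (by simp only [avgDensity, h, integral_zero, mul_zero])
  have h1 := hρ _ (left_ne_zero_of_mul hθ)
  have h2 := (norm_cons_le_iff hR).1 (hfR _ (right_ne_zero_of_mul hθ))
  have h3 : ‖z 0 • θ + Fin.tail z‖ ≤ R := by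
    refine le_trans ?_ h2.2
    rw [norm_smul, Real.norm_of_nonneg (by linarith)]
    exact le_mul_of_one_le_left (norm_nonneg _) hs
  have h4 : ‖Fin.tail z‖ ≤ R + R := by
    calc ‖Fin.tail z‖ = ‖(z 0 • θ + Fin.tail z) - z 0 • θ‖ := by rw [add_sub_cancel_left]
      _ ≤ ‖z 0 • θ + Fin.tail z‖ + ‖z 0 • θ‖ := norm_sub_le _ _
      _ ≤ R + R := by
        gcongr
        rw [norm_smul, Real.norm_eq_abs]
        exact (mul_le_of_le_one_right (abs_nonneg _) h1).trans h2.1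
  rw [← Fin.cons_self_tail z, norm_cons_le_iff (by positivity)]
  constructor <;> linarith [h2.1]

theorem setIntegral_slice (hR : 0 ≤ R) (hfR : ∀ x, f x ≠ 0 → ‖x‖ ≤ R) (k : (Fin m → ℝ) → ℝ)
    (t : ℝ) :
    ∫ y, k y * f (Fin.cons t y) =
      ∫ y in Metric.closedBall 0 R, k y * f (Fin.cons t y) := by
  refine (setIntegral_eq_integral_of_forall_compl_eq_zero fun y hy => ?_).symm
  have : f (Fin.cons t y) = 0 := by
    by_contra h
    exact hy (mem_closedBall_zero_iff.2 ((norm_cons_le_iff hR).1 (hfR _ h)).2)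
  rw [this, mul_zero]

theorem continuous_integral_slice (hf : Continuous f) (hR : 0 ≤ R)
    (hfR : ∀ x, f x ≠ 0 → ‖x‖ ≤ R) : Continuous fun t : ℝ => ∫ y : Fin m → ℝ, f (Fin.cons t y) := by
  have h := fun t => setIntegral_slice hR hfR (fun _ => 1) t
  simp only [one_mul] at h
  simp_rw [h]
  exact continuous_parametric_integral_of_continuous (f := fun t y => f (Fin.cons t y))
    (hf.comp continuous_cons) (isCompact_closedBall _ _)

theorem apply_cons_eq_zero (hfa : ∀ x, f x ≠ 0 → a ≤ |x 0|) {t : ℝ} (ht : |t| < a)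
    (y : Fin m → ℝ) : f (Fin.cons t y) = 0 := by
  by_contra h
  exact absurd (hfa _ h) (by simpa using ht)

theorem continuous_limDensity (hρc : Continuous ρ) (hf : Continuous f)
    (ha : 0 < a) (hfa : ∀ x, f x ≠ 0 → a ≤ |x 0|) (hR : 0 ≤ R) (hfR : ∀ x, f x ≠ 0 → ‖x‖ ≤ R) :
    Continuous (limDensity ρ f) := by
  have h0 : Continuous fun z : Fin (m + 1) → ℝ => z 0 := continuous_apply 0
  have htail : Continuous fun z : Fin (m + 1) → ℝ => Fin.tail z :=
    continuous_pi fun i => continuous_apply i.succ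
  refine continuous_iff_continuousAt.2 fun z => ?_
  by_cases hz : z 0 = 0
  · have : limDensity ρ f =ᶠ[𝓝 z] fun _ => 0 := by
      have hlt : ∀ᶠ w in 𝓝 z, |w 0| < a :=
        h0.abs.continuousAt.eventually_lt_const (by simpa [hz] using ha)
      filter_upwards [hlt] with w hw
      simp [limDensity, apply_cons_eq_zero hfa hw]
    exact continuousAt_const.congr this.symm
  · have hinv : ContinuousAt (fun w : Fin (m + 1) → ℝ => (w 0)⁻¹) z := h0.continuousAt.inv₀ hz
    refine ContinuousAt.mul ((h0.abs.pow m).continuousAt.inv₀ (pow_ne_zero _ (abs_ne_zero.2 hz))) ?_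
    refine ContinuousAt.mul ?_ ((continuous_integral_slice hf hR hfR).comp h0).continuousAt
    exact hρc.continuousAt.comp (hinv.smul htail.continuousAt).neg

theorem integral_limDensity (hρc : Continuous ρ) (hρ : ∀ θ, ρ θ ≠ 0 → ‖θ‖ ≤ 1)
    (hρ1 : ∫ θ, ρ θ = 1) (hf : Continuous f)
    (ha : 0 < a) (hfa : ∀ x, f x ≠ 0 → a ≤ |x 0|) (hR : 0 ≤ R) (hfR : ∀ x, f x ≠ 0 → ‖x‖ ≤ R) :
    ∫ z, limDensity ρ f z = ∫ x, f x := by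
  have hcs : ∀ {C : ℝ} {F : (Fin (m + 1) → ℝ) → ℝ}, Continuous F → (∀ x, F x ≠ 0 → ‖x‖ ≤ C) →
      Integrable F := fun {C F} hF hC =>
    hF.integrable_of_hasCompactSupport (HasCompactSupport.intro (isCompact_closedBall 0 C)
      fun x hx => not_not.1 fun h => hx (mem_closedBall_zero_iff.2 (hC x h)))
  rw [integral_eq_integral_cons (hcs hf hfR), integral_eq_integral_cons
    (hcs (continuous_limDensity hρc hf ha hfa hR hfR)
      fun x => norm_le_of_limDensity_ne_zero hρ ha hfa hR hfR)]
  refine integral_congr_ae (Eventually.of_forall fun t => ?_)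
  simp only [limDensity, Fin.cons_zero, Fin.tail_cons]
  rcases eq_or_ne t 0 with rfl | ht
  · simp [apply_cons_eq_zero hfa (t := 0) (by simpa using ha)]
  · rw [integral_const_mul, integral_mul_const]
    have : ∫ y : Fin m → ℝ, ρ (-(t⁻¹ • y)) = |t| ^ m := by
      simp_rw [← neg_smul]
      rw [Measure.integral_comp_smul, hρ1, Module.finrank_fin_fun]
      simp
    rw [this, ← mul_assoc, inv_mul_cancel₀ (by positivity), one_mul]

theorem abs_avgDensity_sub_limDensity_le (hρu : UniformContinuous ρ)
    (hf : Continuous f) (hfb : ∃ M, ∀ x, |f x| ≤ M)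
    (ha : 0 < a) (hfa : ∀ x, f x ≠ 0 → a ≤ |x 0|) (hR : 0 ≤ R) (hfR : ∀ x, f x ≠ 0 → ‖x‖ ≤ R)
    {ε : ℝ} (hε : 0 < ε) :
    ∀ᶠ s : ℝ in atTop, ∀ z, |avgDensity ρ f s z - limDensity ρ f z| ≤ ε := by
  obtain ⟨M, hM⟩ := hfb
  have hM0 : 0 ≤ M := (abs_nonneg _).trans (hM 0)
  set V : ℝ := volume.real (Metric.closedBall (0 : Fin m → ℝ) R) with hV
  have hV0 : 0 ≤ V := measureReal_nonneg
  set η : ℝ := ε * a ^ m / (M * V + 1) with hη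
  have hη0 : 0 < η := by positivity
  obtain ⟨δ, hδ, hρδ⟩ := Metric.uniformContinuous_iff.1 hρu η hη0
  filter_upwards [eventually_gt_atTop 0, eventually_gt_atTop (R / (a * δ))] with s hs hsδ z
  by_cases hz : |z 0| < a
  · simp [avgDensity, limDensity, apply_cons_eq_zero hfa hz, hε.le]
  rw [not_lt] at hz
  have hz0 : z 0 ≠ 0 := abs_pos.1 (ha.trans_le hz)
  have hcf : Continuous fun y : Fin m → ℝ => f (Fin.cons (z 0) y) :=
    hf.comp (continuous_cons.comp (continuous_const.prodMk continuous_id))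
  have hcρ : Continuous fun y : Fin m → ℝ => ρ ((z 0)⁻¹ • (s⁻¹ • y - Fin.tail z)) :=
    hρu.continuous.comp (by fun_prop)
  have hcomp : IsCompact (Metric.closedBall (0 : Fin m → ℝ) R) := isCompact_closedBall _ _
  have hpt : ∀ y ∈ Metric.closedBall (0 : Fin m → ℝ) R,
      ‖(ρ ((z 0)⁻¹ • (s⁻¹ • y - Fin.tail z)) * f (Fin.cons (z 0) y) -
        ρ (-((z 0)⁻¹ • Fin.tail z)) * f (Fin.cons (z 0) y))‖ ≤ η * M := by
    intro y hy
    rw [← sub_mul, norm_mul]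
    have hd : dist ((z 0)⁻¹ • (s⁻¹ • y - Fin.tail z)) (-((z 0)⁻¹ • Fin.tail z)) < δ := by
      rw [dist_eq_norm, smul_sub, sub_neg_eq_add, sub_add_cancel, norm_smul, norm_smul,
        norm_inv, norm_inv, Real.norm_eq_abs, Real.norm_of_nonneg hs.le]
      rw [mem_closedBall_zero_iff] at hy
      calc |z 0|⁻¹ * (s⁻¹ * ‖y‖) ≤ a⁻¹ * (s⁻¹ * R) := by gcongr
        _ = R / a / s := by ring
        _ < δ := by
          rw [div_lt_iff₀ hs]
          rw [div_lt_iff₀ (by positivity)] at hsδ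
          rw [div_lt_iff₀ ha]
          linarith
    exact mul_le_mul (hρδ hd).le (hM _) (norm_nonneg _) hη0.le
  have hi1 : IntegrableOn (fun y => ρ ((z 0)⁻¹ • (s⁻¹ • y - Fin.tail z)) * f (Fin.cons (z 0) y))
      (Metric.closedBall 0 R) volume :=
    (hcρ.mul hcf).continuousOn.integrableOn_compact hcomp
  have hi2 : IntegrableOn (fun y => ρ (-((z 0)⁻¹ • Fin.tail z)) * f (Fin.cons (z 0) y))
      (Metric.closedBall 0 R) volume :=
    (continuous_const.mul hcf).continuousOn.integrableOn_compact hcomp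
  rw [avgDensity_eq ρ f hs hz0, limDensity, ← mul_sub, ← integral_const_mul,
    setIntegral_slice hR hfR, setIntegral_slice hR hfR,
    ← integral_sub hi1 hi2, abs_mul, abs_inv,
    abs_pow, abs_abs]
  have hint := norm_setIntegral_le_of_norm_le_const
    (hcomp.measure_lt_top (μ := volume)) hpt
  rw [Real.norm_eq_abs] at hint
  calc _ ≤ (a ^ m)⁻¹ * (η * M * V) := by gcongr
    _ = ε * ((M * V) / (M * V + 1)) := by rw [hη]; field_simp
    _ ≤ ε * 1 := by
      gcongr
      rw [div_le_one (by positivity)]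
      linarith
    _ = ε := mul_one ε

end Kernel

section Expanding

variable {m : ℕ} {T τ : ℝ}

/-- A matrix expanding the last `m` coordinates, times a lower triangular unipotent matrix. -/
def expandingMatrix (T τ : ℝ) (θ : Fin m → ℝ) : Matrix (Fin (m + 1)) (Fin (m + 1)) ℝ :=
  Matrix.of (Fin.cons (Fin.cons T⁻¹ 0) fun i => Fin.cons (τ * θ i) (Pi.single i τ))

theorem det_expandingMatrix (hT : T ≠ 0) (hτ : τ ^ m = T) (θ : Fin m → ℝ) :
    (expandingMatrix T τ θ).det = 1 := by
  rw [Matrix.det_of_isLowerTriangular]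
  · simp [expandingMatrix, Fin.prod_univ_succ, hτ, hT]
  · intro i j hij
    change i < j at hij
    refine Fin.cases (fun h => ?_) (fun i h => ?_) i hij
    · refine Fin.cases (fun h => absurd h (lt_irrefl _)) (fun j _ => ?_) j h
      simp [expandingMatrix]
    · refine Fin.cases (fun h => absurd h (Fin.not_lt_zero _)) (fun j h => ?_) j h
      have : j ≠ i := ((Fin.succ_lt_succ_iff.1 h).ne).symm
      simp [expandingMatrix, this]

theorem expandingMatrix_mulVec (θ : Fin m → ℝ) (x : Fin (m + 1) → ℝ) :
    (expandingMatrix T τ θ).mulVec x =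
      Fin.cons (T⁻¹ * x 0) (τ • (x 0 • θ + Fin.tail x)) := by
  ext i
  refine Fin.cases ?_ (fun i => ?_) i
  · simp [expandingMatrix, Matrix.mulVec, dotProduct, Fin.sum_univ_succ]
  · simp [expandingMatrix, Matrix.mulVec, dotProduct, Fin.sum_univ_succ, Pi.single_apply, Fin.tail]
    ring

/-- `expandingMatrix` as an element of `SL_{m+1}(ℝ)`. -/
def expanding (hT : T ≠ 0) (hτ : τ ^ m = T) (θ : Fin m → ℝ) : SLR (m + 1) :=
  ⟨expandingMatrix T τ θ, det_expandingMatrix hT hτ θ⟩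

theorem continuous_expanding (hT : T ≠ 0) (hτ : τ ^ m = T) : Continuous (expanding hT hτ) := by
  refine continuous_induced_rng.2 (continuous_matrix fun i j => ?_)
  change Continuous fun θ => expandingMatrix T τ θ i j
  refine Fin.cases ?_ (fun i => ?_) i
  · simpa [expandingMatrix] using continuous_const
  · refine Fin.cases ?_ (fun j => ?_) j
    · simp only [expandingMatrix, Matrix.of_apply, Fin.cons_succ, Fin.cons_zero]
      fun_prop
    · simpa [expandingMatrix] using continuous_const

variable {ρ : (Fin m → ℝ) → ℝ} {f : (Fin (m + 1) → ℝ) → ℝ}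

theorem lintegral_expanding (hT : 0 < T) (hτ : τ ^ m = T) (hτ0 : 0 < τ) (hρc : Continuous ρ)
    (hρcs : HasCompactSupport ρ) (hρ0 : ∀ θ, 0 ≤ ρ θ) (hf : Continuous f) (hf0 : ∀ x, 0 ≤ f x)
    (x : Fin (m + 1) → ℝ) :
    ∫⁻ θ, ENNReal.ofReal (f ((expandingMatrix T τ θ).mulVec x))
        ∂(volume.withDensity fun θ => ENNReal.ofReal (ρ θ)) =
      ENNReal.ofReal (avgDensity ρ f (τ * T) (T⁻¹ • x) / T ^ (m + 1)) := by
  have hc : Continuous fun θ : Fin m → ℝ => f ((expandingMatrix T τ θ).mulVec x) := by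
    simp_rw [expandingMatrix_mulVec]
    exact hf.comp (continuous_cons.comp (continuous_const.prodMk (by fun_prop)))
  have he : avgDensity ρ f (τ * T) (T⁻¹ • x) / T ^ (m + 1) =
      ∫ θ, ρ θ * f ((expandingMatrix T τ θ).mulVec x) := by
    have h2 : ∀ θ : Fin m → ℝ, (τ * T) • ((T⁻¹ • x) 0 • θ + Fin.tail (T⁻¹ • x)) =
        τ • (x 0 • θ + Fin.tail x) := by
      intro θ
      ext i
      simp only [Pi.smul_apply, Pi.add_apply, smul_eq_mul, Fin.tail]
      field_simp
    simp_rw [expandingMatrix_mulVec, avgDensity, h2, mul_pow, hτ, Pi.smul_apply, smul_eq_mul]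
    rw [← pow_succ', mul_div_cancel_left₀ _ (by positivity)]
  rw [he, lintegral_withDensity_eq_lintegral_mul _ hρc.measurable.ennreal_ofReal
    hc.measurable.ennreal_ofReal, ofReal_integral_eq_lintegral_ofReal]
  · refine lintegral_congr fun θ => ?_
    rw [ENNReal.ofReal_mul (hρ0 θ)]
    rfl
  · exact (hρc.mul hc).integrable_of_hasCompactSupport hρcs.mul_right
  · exact Eventually.of_forall fun θ => mul_nonneg (hρ0 θ) (hf0 _)

end Expanding

section Intensity

variable {m : ℕ}

theorem tendsto_lintegral_latSum_expanding (hm : m ≠ 0) {ρ : (Fin m → ℝ) → ℝ}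
    {f : (Fin (m + 1) → ℝ) → ℝ} {a R : ℝ} (hρc : Continuous ρ)
    (hρcs : HasCompactSupport ρ) (hρ0 : ∀ θ, 0 ≤ ρ θ) (hρ : ∀ θ, ρ θ ≠ 0 → ‖θ‖ ≤ 1)
    (hρ1 : ∫ θ, ρ θ = 1) (hf : Continuous f) (hfcs : HasCompactSupport f) (hf0 : ∀ x, 0 ≤ f x)
    (ha : 0 < a) (hfa : ∀ x, f x ≠ 0 → a ≤ |x 0|) (hR : 0 ≤ R) (hfR : ∀ x, f x ≠ 0 → ‖x‖ ≤ R)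
    {T τ : ℕ → ℝ} (hT : ∀ k, T k = k + 1) (hT0 : ∀ k, T k ≠ 0) (hτ : ∀ k, τ k ^ m = T k)
    (hτ0 : ∀ k, 0 < τ k) (g : SLR (m + 1)) :
    Tendsto (fun k => ∫⁻ θ, latSum (fun x => ENNReal.ofReal (f x)) (expanding (hT0 k) (hτ k) θ * g)
        ∂(volume.withDensity fun θ => ENNReal.ofReal (ρ θ)))
      atTop (𝓝 (ENNReal.ofReal (∫ x, f x))) := by
  have hTpos : ∀ k, 0 < T k := fun k => by rw [hT]; positivity
  have hτ1 : ∀ k, 1 ≤ τ k := fun k => by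
    by_contra! h
    have := pow_lt_one₀ (hτ0 k).le h hm
    rw [hτ, hT] at this
    linarith [(Nat.cast_nonneg k : (0 : ℝ) ≤ k)]
  set Φ : ℕ → (Fin (m + 1) → ℝ) → ℝ := fun N => avgDensity ρ f (τ (N - 1) * T (N - 1)) with hΦ
  have hs1 : ∀ k, T k ≤ τ k * T k := fun k => le_mul_of_one_le_left (hTpos k).le (hτ1 k)
  have hTN : ∀ N : ℕ, 0 < N → T (N - 1) = N := fun N hN => by
    rw [hT]
    exact_mod_cast Nat.sub_add_cancel hN
  have hΦC : ∀ N x, 0 < N → Φ N x ≠ 0 → ‖x‖ ≤ 2 * R := fun N x hN hx => by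
    refine norm_le_of_avgDensity_ne_zero hρ hR hfR ((?_ : (1 : ℝ) ≤ _).trans (hs1 (N - 1))) hx
    rw [hTN N hN]
    exact_mod_cast hN
  have hs : Tendsto (fun N : ℕ => τ (N - 1) * T (N - 1)) atTop atTop := by
    refine tendsto_atTop_mono' _ ?_ (tendsto_natCast_atTop_atTop (R := ℝ))
    filter_upwards [eventually_gt_atTop 0] with N hN
    rw [← hTN N hN]
    exact hs1 (N - 1)
  have hlim := tendsto_tsum_lattice_of_uniform g
    (continuous_limDensity hρc hf ha hfa hR hfR)
    (fun x => norm_le_of_limDensity_ne_zero hρ ha hfa hR hfR) hΦC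
    (fun ε hε => hs.eventually (abs_avgDensity_sub_limDensity_le
      (hρcs.uniformContinuous_of_continuous hρc) hf
      (by simpa using hfcs.exists_bound_of_continuous hf) ha hfa hR hfR hε))
  rw [integral_limDensity hρc hρ hρ1 hf ha hfa hR hfR] at hlim
  refine (ENNReal.tendsto_ofReal (hlim.comp (tendsto_add_atTop_nat 1))).congr fun k => ?_
  have hmeas : ∀ v : Fin (m + 1) → ℤ, Measurable fun θ => ENNReal.ofReal
      (f (((expanding (hT0 k) (hτ k) θ * g : SLR (m + 1)) :
        Matrix (Fin (m + 1)) (Fin (m + 1)) ℝ).mulVec (intVec v))) := fun v =>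
    (hf.comp ((continuous_coe.comp ((continuous_expanding (hT0 k) (hτ k)).mul
      continuous_const)).matrix_mulVec continuous_const)).measurable.ennreal_ofReal
  have hTk : ((k + 1 : ℕ) : ℝ) = T k := by rw [hT]; push_cast; rfl
  simp only [latSum]
  rw [lintegral_tsum fun v : {v : Fin (m + 1) → ℤ // v ≠ 0} => (hmeas v).aemeasurable]
  simp only [Function.comp_apply, hΦ, Nat.add_sub_cancel, hTk]
  set b : (Fin (m + 1) → ℤ) → ℝ := fun v => avgDensity ρ f (τ k * T k)
    ((T k)⁻¹ • (g : Matrix (Fin (m + 1)) (Fin (m + 1)) ℝ).mulVec (intVec v)) with hb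
  have hb0 : ∀ v, 0 ≤ b v := fun v => mul_nonneg (pow_nonneg (mul_pos (hτ0 k) (hTpos k)).le _)
    (integral_nonneg fun θ => mul_nonneg (hρ0 θ) (hf0 _))
  have hbs : Summable b := by
    have := finite_support_lattice g (hΦC (k + 1) · k.succ_pos) (hTpos k)
    simp only [hΦ, Nat.add_sub_cancel] at this
    exact summable_of_hasFiniteSupport (L := .unconditional _) this
  have hbz : b 0 = 0 := by
    have : ∀ y : Fin m → ℝ, f (Fin.cons 0 y) = 0 :=
      apply_cons_eq_zero hfa (by simpa using ha)
    have hz : (intVec (0 : Fin (m + 1) → ℤ)) = 0 := by ext; simp [intVec]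
    simp [hb, hz, avgDensity, this]
  have hterm : ∀ v : Fin (m + 1) → ℤ, ∫⁻ θ, ENNReal.ofReal
      (f (((expanding (hT0 k) (hτ k) θ * g : SLR (m + 1)) :
        Matrix (Fin (m + 1)) (Fin (m + 1)) ℝ).mulVec (intVec v)))
        ∂(volume.withDensity fun θ => ENNReal.ofReal (ρ θ)) =
      ENNReal.ofReal (b v / T k ^ (m + 1)) := fun v => by
    rw [hb, ← lintegral_expanding (hTpos k) (hτ k) (hτ0 k) hρc hρcs hρ0 hf hf0]
    simp_rw [Matrix.SpecialLinearGroup.coe_mul, ← Matrix.mulVec_mulVec]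
    rfl
  simp_rw [hterm]
  refine Eq.trans ?_ (tsum_subtype_eq_of_support_subset
    (f := fun v => ENNReal.ofReal (b v / T k ^ (m + 1)))
    (s := {v | v ≠ 0}) fun v hv h => hv (by simp [h, hbz])).symm
  rw [← ENNReal.ofReal_tsum_of_nonneg (fun v => div_nonneg (hb0 v) (pow_pos (hTpos k) _).le)
    (hbs.div_const _), tsum_div_const]

theorem lintegral_intensity_eq_of_tsupport_subset (hm : m ≠ 0) {μ : Measure (XQuot (m + 1))}
    [IsProbabilityMeasure μ] (hinv : ∀ g : SLR (m + 1), Measure.map (fun x => g • x) μ = μ)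
    {f : (Fin (m + 1) → ℝ) → ℝ} (hf : Continuous f) (hfcs : HasCompactSupport f)
    (hf0 : ∀ x, 0 ≤ f x) (hfs : tsupport f ⊆ {x | x 0 ≠ 0}) :
    ∫⁻ x, ENNReal.ofReal (f x) ∂(intensity μ) = ∫⁻ x, ENNReal.ofReal (f x) := by
  obtain ⟨R, hR, hfR⟩ : ∃ R, 0 ≤ R ∧ ∀ x, f x ≠ 0 → ‖x‖ ≤ R := by
    obtain ⟨R, hR⟩ := hfcs.isBounded.subset_closedBall 0
    exact ⟨max R 0, le_max_right _ _, fun x hx => (mem_closedBall_zero_iff.1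
      (hR (subset_tsupport f hx))).trans (le_max_left _ _)⟩
  obtain ⟨a, ha, hfa⟩ : ∃ a, 0 < a ∧ ∀ x, f x ≠ 0 → a ≤ |x 0| := by
    have hc : ContinuousOn (fun x : Fin (m + 1) → ℝ => |x 0|) (tsupport f) :=
      (continuous_apply 0).abs.continuousOn
    rcases (tsupport f).eq_empty_or_nonempty with h | h
    · exact ⟨1, one_pos, fun x hx => absurd (subset_tsupport f hx) (by simp [h])⟩
    · obtain ⟨x, hx, hmin⟩ := hfcs.isCompact.exists_isMinOn h hc
      exact ⟨|x 0|, abs_pos.2 (hfs hx), fun y hy => hmin (subset_tsupport f hy)⟩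
  let β : ContDiffBump (0 : Fin m → ℝ) := ⟨1 / 2, 1, by norm_num, by norm_num⟩
  set ρ : (Fin m → ℝ) → ℝ := β.normed volume
  have hρcs : HasCompactSupport ρ := β.hasCompactSupport_normed
  have hρ : ∀ θ, ρ θ ≠ 0 → ‖θ‖ ≤ 1 := fun θ hθ => by
    have : θ ∈ Function.support ρ := hθ
    rw [β.support_normed_eq, mem_ball_zero_iff] at this
    exact this.le
  have hprob : IsProbabilityMeasure
      (volume.withDensity fun θ : Fin m → ℝ => ENNReal.ofReal (ρ θ)) := ⟨by
    rw [withDensity_apply _ MeasurableSet.univ, Measure.restrict_univ,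
      ← ofReal_integral_eq_lintegral_ofReal β.integrable_normed
        (Eventually.of_forall β.nonneg_normed), β.integral_normed, ENNReal.ofReal_one]⟩
  set T : ℕ → ℝ := fun k => k + 1
  have hT0 : ∀ k, T k ≠ 0 := fun k => by positivity
  set τ : ℕ → ℝ := fun k => T k ^ ((m : ℝ)⁻¹)
  have hτ : ∀ k, τ k ^ m = T k := fun k => Real.rpow_inv_natCast_pow (by positivity) hm
  have hτ0 : ∀ k, 0 < τ k := fun k => Real.rpow_pos_of_pos (by positivity) _
  have hfm := hf.measurable.ennreal_ofReal
  rw [lintegral_intensity μ hfm, ← ofReal_integral_eq_lintegral_ofReal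
    (hf.integrable_of_hasCompactSupport hfcs) (Eventually.of_forall hf0)]
  refine lintegral_eq_of_tendsto_average (measurable_lintegral_pointMeasure hfm)
    (a := fun k θ x => expanding (hT0 k) (hτ k) θ • x) (fun k => ?_) (fun k θ => hinv _)
    (σ := volume.withDensity fun θ => ENNReal.ofReal (ρ θ)) fun x => ?_
  · exact Continuous.measurable (f := fun p : (Fin m → ℝ) × XQuot (m + 1) =>
      expanding (hT0 k) (hτ k) p.1 • p.2)
      (((continuous_expanding (hT0 k) (hτ k)).comp continuous_fst).smul continuous_snd)
  · obtain ⟨g, rfl⟩ := QuotientGroup.mk_surjective x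
    refine (tendsto_lintegral_latSum_expanding hm β.continuous_normed hρcs β.nonneg_normed hρ
      β.integral_normed hf hfcs hf0 ha hfa hR hfR (fun _ => rfl) hT0 hτ hτ0 g).congr fun k => ?_
    refine lintegral_congr fun θ => ?_
    exact (lintegral_pointMeasure hfm _).symm

end Intensity

section Formula

variable {n m : ℕ}

theorem mulVec_intVec_ne_zero (g : SLR n) {v : Fin n → ℤ} (hv : v ≠ 0) :
    (g : Matrix (Fin n) (Fin n) ℝ).mulVec (intVec v) ≠ 0 := by
  obtain ⟨K, -, h⟩ := norm_le_mul_norm_mulVec g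
  intro h0
  have h1 := h (intVec v)
  rw [h0, norm_zero, mul_zero] at h1
  refine hv (funext fun i => ?_)
  have h2 : (v i : ℝ) = 0 := congrFun (norm_le_zero_iff.1 h1) i
  exact_mod_cast h2

theorem intensity_singleton_zero (μ : Measure (XQuot n)) : intensity μ {0} = 0 := by
  have hf : Measurable (Set.indicator {(0 : Fin n → ℝ)} (1 : (Fin n → ℝ) → ℝ≥0∞)) :=
    measurable_one.indicator (measurableSet_singleton 0)
  rw [← lintegral_indicator_one (measurableSet_singleton 0), lintegral_intensity μ hf]
  refine lintegral_eq_zero_of_ae_eq_zero (Eventually.of_forall fun x => ?_)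
  obtain ⟨g, rfl⟩ := QuotientGroup.mk_surjective x
  exact (lintegral_pointMeasure hf g).trans (ENNReal.tsum_eq_zero.2 fun v =>
    Set.indicator_of_notMem (Set.notMem_singleton_iff.2 (mulVec_intVec_ne_zero g v.2)) _)

/-- Two measures invariant under `SL_n(ℝ)` which agree on a set agree on its translates. -/
theorem restrict_preimage_mulVec_eq {ν₁ ν₂ : Measure (Fin n → ℝ)} {H : Set (Fin n → ℝ)}
    (hH : MeasurableSet H) (h : ν₁.restrict H = ν₂.restrict H)
    (h₁ : ∀ g : SLR n, ν₁.map (fun y => (g : Matrix (Fin n) (Fin n) ℝ).mulVec y) = ν₁)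
    (h₂ : ∀ g : SLR n, ν₂.map (fun y => (g : Matrix (Fin n) (Fin n) ℝ).mulVec y) = ν₂)
    (g : SLR n) :
    ν₁.restrict ((fun y => (g : Matrix (Fin n) (Fin n) ℝ).mulVec y) ⁻¹' H) =
      ν₂.restrict ((fun y => (g : Matrix (Fin n) (Fin n) ℝ).mulVec y) ⁻¹' H) := by
  have hm : ∀ g : SLR n, Measurable fun y => (g : Matrix (Fin n) (Fin n) ℝ).mulVec y := fun g =>
    (Continuous.matrix_mulVec continuous_const continuous_id).measurable
  rw [← h₁ g⁻¹, ← h₂ g⁻¹, Measure.restrict_map (hm _) (hm g hH),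
    Measure.restrict_map (hm _) (hm g hH)]
  have e : (fun y => ((g⁻¹ : SLR n) : Matrix (Fin n) (Fin n) ℝ).mulVec y) ⁻¹'
      ((fun y => (g : Matrix (Fin n) (Fin n) ℝ).mulVec y) ⁻¹' H) = H := by
    ext y
    simp only [Set.mem_preimage]
    rw [Matrix.mulVec_mulVec, ← Matrix.SpecialLinearGroup.coe_mul, mul_inv_cancel,
      Matrix.SpecialLinearGroup.coe_one, Matrix.one_mulVec]
  rw [e, h]

theorem exists_mulVec_apply_zero_ne_zero : ∃ g : Fin (m + 1) → SLR (m + 1),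
    ∀ x : Fin (m + 1) → ℝ, x ≠ 0 →
      ∃ i, ((g i : SLR (m + 1)) : Matrix (Fin (m + 1)) (Fin (m + 1)) ℝ).mulVec x 0 ≠ 0 := by
  refine ⟨Fin.cons 1 fun i => ⟨Matrix.transvection 0 i.succ 1,
    Matrix.det_transvection_of_ne _ _ (Fin.succ_ne_zero i).symm 1⟩, fun x hx => ?_⟩
  by_cases h0 : x 0 = 0
  · obtain ⟨i, hi⟩ := Function.ne_iff.1 hx
    refine Fin.cases (fun h => absurd h0 h) (fun i hi => ⟨i.succ, ?_⟩) i hi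
    change (Matrix.transvection 0 i.succ (1 : ℝ)).mulVec x 0 ≠ 0
    simpa [Matrix.transvection, Matrix.add_mulVec, Matrix.single_mulVec, h0] using hi
  · refine ⟨0, ?_⟩
    change (1 : Matrix (Fin (m + 1)) (Fin (m + 1)) ℝ).mulVec x 0 ≠ 0
    rwa [Matrix.one_mulVec]

theorem intensity_eq_volume (hm : m ≠ 0) {μ : Measure (XQuot (m + 1))}
    [IsProbabilityMeasure μ] (hinv : ∀ g : SLR (m + 1), Measure.map (fun x => g • x) μ = μ) :
    intensity μ = volume := by
  have hH : IsOpen {x : Fin (m + 1) → ℝ | x 0 ≠ 0} :=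
    isOpen_ne.preimage (continuous_apply 0)
  have hres := restrict_eq_of_lintegral_eq (μ := intensity μ) (ν := volume) hH
    fun f h1 h2 h3 h4 => lintegral_intensity_eq_of_tsupport_subset hm hinv h1 h2 h3 h4
  obtain ⟨g, hg⟩ := exists_mulVec_apply_zero_ne_zero (m := m)
  refine Measure.ext_of_iUnion_eq_univ (s := fun o : Option (Fin (m + 1)) => o.elim {0} fun i =>
    (fun y => ((g i : SLR (m + 1)) : Matrix (Fin (m + 1)) (Fin (m + 1)) ℝ).mulVec y) ⁻¹'
      {x | x 0 ≠ 0}) ?_ fun o => ?_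
  · refine Set.eq_univ_of_forall fun x => Set.mem_iUnion.2 ?_
    by_cases hx : x = 0
    · exact ⟨none, hx⟩
    · obtain ⟨i, hi⟩ := hg x hx
      exact ⟨some i, hi⟩
  · cases o with
    | none =>
      rw [Option.elim_none, Measure.restrict_eq_zero.2 (intensity_singleton_zero μ),
        Measure.restrict_eq_zero.2 (measure_singleton 0)]
    | some i =>
      exact restrict_preimage_mulVec_eq hH.measurableSet hres (map_mulVec_intensity hinv)
        map_mulVec_volume (g i)

theorem tsum_eq_toReal_sub_toReal {f : (Fin n → ℝ) → ℝ} (hf : Measurable f)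
    (hfcs : HasCompactSupport f) (g : SLR n) :
    ∑' v : {v : Fin n → ℤ // v ≠ 0}, f ((g : Matrix (Fin n) (Fin n) ℝ).mulVec (intVec v)) =
      (∫⁻ y, ENNReal.ofReal (f y) ∂(pointMeasure (QuotientGroup.mk g : XQuot n))).toReal -
      (∫⁻ y, ENNReal.ofReal (-f y) ∂(pointMeasure (QuotientGroup.mk g : XQuot n))).toReal := by
  obtain ⟨R, hR⟩ := hfcs.isBounded.subset_closedBall 0
  have hfin : (Function.support fun v : {v : Fin n → ℤ // v ≠ 0} =>
      f ((g : Matrix (Fin n) (Fin n) ℝ).mulVec (intVec v))).Finite :=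
    ((finite_norm_mulVec_intVec_le g R).preimage Subtype.val_injective.injOn).subset fun v hv =>
      mem_closedBall_zero_iff.1 (hR (subset_tsupport f hv))
  have hs : ∀ φ : ℝ → ℝ, φ 0 = 0 → Summable fun v : {v : Fin n → ℤ // v ≠ 0} =>
      φ (f ((g : Matrix (Fin n) (Fin n) ℝ).mulVec (intVec v))) := fun φ hφ =>
    summable_of_hasFiniteSupport (L := .unconditional _)
      (hfin.subset fun v hv h => hv (by simp only [h, hφ]))
  rw [lintegral_pointMeasure hf.ennreal_ofReal, lintegral_pointMeasure hf.fun_neg.ennreal_ofReal,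
    latSum, latSum, ENNReal.tsum_toReal_eq fun _ => ENNReal.ofReal_ne_top,
    ENNReal.tsum_toReal_eq fun _ => ENNReal.ofReal_ne_top]
  simp_rw [ENNReal.toReal_ofReal']
  rw [← (hs (fun t => max t 0) (by simp)).tsum_sub (hs (fun t => max (-t) 0) (by simp))]
  exact tsum_congr fun v => (max_zero_sub_max_neg_zero_eq_self _).symm

theorem integral_eq_of_intensity_eq_volume {μ : Measure (XQuot n)} (hμ : intensity μ = volume)
    {f : (Fin n → ℝ) → ℝ} (hf : Measurable f) (hfi : Integrable f) (hfcs : HasCompactSupport f)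
    {fhat : XQuot n → ℝ} (hfhat : ∀ g : SLR n, fhat (QuotientGroup.mk g) =
      ∑' v : {v : Fin n → ℤ // v ≠ 0}, f ((g : Matrix (Fin n) (Fin n) ℝ).mulVec (intVec v))) :
    ∫ x, fhat x ∂μ = ∫ x, f x := by
  have hpart : ∀ h : (Fin n → ℝ) → ℝ, Measurable h → Integrable h →
      Integrable (fun x => (∫⁻ y, ENNReal.ofReal (h y) ∂(pointMeasure x)).toReal) μ ∧
      ∫ x, (∫⁻ y, ENNReal.ofReal (h y) ∂(pointMeasure x)).toReal ∂μ =
        (∫⁻ y, ENNReal.ofReal (h y)).toReal := by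
    intro h hh hhi
    have hm := measurable_lintegral_pointMeasure (n := n) hh.ennreal_ofReal
    have he : ∫⁻ x, ∫⁻ y, ENNReal.ofReal (h y) ∂(pointMeasure x) ∂μ =
        ∫⁻ y, ENNReal.ofReal (h y) := by
      rw [← lintegral_intensity μ hh.ennreal_ofReal, hμ]
    have hfin : ∫⁻ x, ∫⁻ y, ENNReal.ofReal (h y) ∂(pointMeasure x) ∂μ ≠ ⊤ := by
      rw [he]
      exact hhi.lintegral_lt_top.ne
    exact ⟨integrable_toReal_of_lintegral_ne_top hm.aemeasurable hfin, by
      rw [integral_toReal hm.aemeasurable (ae_lt_top hm hfin), he]⟩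
  have hx : ∀ x, fhat x = (∫⁻ y, ENNReal.ofReal (f y) ∂(pointMeasure x)).toReal -
      (∫⁻ y, ENNReal.ofReal (-f y) ∂(pointMeasure x)).toReal := by
    intro x
    obtain ⟨g, rfl⟩ := QuotientGroup.mk_surjective x
    rw [hfhat, tsum_eq_toReal_sub_toReal hf hfcs]
  obtain ⟨h1, h2⟩ := hpart f hf hfi
  obtain ⟨h3, h4⟩ := hpart (fun y => -f y) hf.fun_neg hfi.fun_neg
  simp_rw [hx]
  rw [integral_sub h1 h3, h2, h4, integral_eq_lintegral_pos_part_sub_lintegral_neg_part hfi]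

end Formula

end SiegelFormula

/-- Siegel's integral formula: for a bounded measurable compactly supported
`f : ℝ^n → ℝ`, the average over the space of unimodular lattices of
`f̂(L) = ∑_{0 ≠ v ∈ L} f(v)` equals `∫_{ℝ^n} f`. -/
theorem siegel_integral_formula (n : ℕ) (hn : 2 ≤ n)
    (μ : Measure (XQuot n)) (hprob : IsProbabilityMeasure μ)
    (hinv : ∀ g : SLR n, Measure.map (fun x => g • x) μ = μ)
    (f : (Fin n → ℝ) → ℝ) (hmeas : Measurable f)
    (hbdd : ∃ M : ℝ, ∀ x, |f x| ≤ M) (hsupp : HasCompactSupport f)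
    (fhat : XQuot n → ℝ)
    (hfhat : ∀ g : SLR n,
      fhat (QuotientGroup.mk g) =
        ∑' v : {v : Fin n → ℤ // v ≠ 0},
          f ((g : Matrix (Fin n) (Fin n) ℝ).mulVec fun i => ((v : Fin n → ℤ) i : ℝ))) :
    ∫ x, fhat x ∂μ = ∫ x, f x := by
  obtain ⟨m, rfl⟩ : ∃ m, n = m + 1 := ⟨n - 1, by omega⟩
  obtain ⟨M, hM⟩ := hbdd
  have hfi : Integrable f := by
    refine (integrableOn_iff_integrable_of_support_subset (subset_tsupport f)).1 ?_
    exact Measure.integrableOn_of_bounded hsupp.isCompact.measure_lt_top.ne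
      hmeas.aestronglyMeasurable (Filter.Eventually.of_forall hM)
  exact SiegelFormula.integral_eq_of_intensity_eq_volume
    (SiegelFormula.intensity_eq_volume (by omega) hinv) hmeas hfi hsupp hfhat
end
end
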